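/- arXiv:1701.06540 — 2 statements merged into one kernel-verified Lean document; each statement's English description precedes it below -/
import Mathlib

section
/- For every valid function ψ : ℝⁿ → ℝ, there exists a maximal S-free convex set B containing f in its interior, B = {x ∈ ℝⁿ : a_i·(x − f) ≤ 1, i = 1,…,k}, such that the function ψ_B(r) = max_{i=1,…,k} a_i·r satisfies ψ_B(r) ≤ ψ(r) for all r ∈ ℝⁿ. -/
open scoped BigOperators Pointwise

noncomputable section

/-- Euclidean space `ℝⁿ`. -/
abbrev E (n : ℕ) := EuclideanSpace ℝ (Fin n)

/-- Dot product on `ℝⁿ`. -/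
def dot {n : ℕ} (x y : E n) : ℝ := ∑ i, x i * y i

/-- A point with integral coordinates. -/
def IsIntPt {n : ℕ} (x : E n) : Prop := ∀ i, ∃ m : ℤ, x i = (m : ℝ)

/-- A vector with rational coordinates. -/
def IsRatVec {n : ℕ} (x : E n) : Prop := ∀ i, ∃ q : ℚ, x i = (q : ℝ)

/-- `S` is the set of integral points of a rational polyhedron `{x | Ax ≤ b}`. -/
def IsIntPtsOfRatPolyhedron {n : ℕ} (S : Set (E n)) : Prop :=
  ∃ (m : ℕ) (A : Fin m → E n) (b : Fin m → ℝ),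
    (∀ i, IsRatVec (A i)) ∧ (∀ i, ∃ q : ℚ, b i = (q : ℝ)) ∧
    S = {x | IsIntPt x ∧ ∀ i, dot (A i) x ≤ b i}

/-- `dim S = n`: `S` contains `n+1` affinely independent points. -/
def FullDimSet {n : ℕ} (S : Set (E n)) : Prop :=
  ∃ p : Fin (n + 1) → E n, (∀ i, p i ∈ S) ∧ AffineIndependent ℝ p

/-- `B` is `S`-free: the interior of `B` contains no point of `S`. -/
def SFree {n : ℕ} (S B : Set (E n)) : Prop := ∀ x ∈ interior B, x ∉ S

/-- `B` is a maximal `S`-free convex set. -/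
def MaxSFree {n : ℕ} (S B : Set (E n)) : Prop :=
  Convex ℝ B ∧ SFree S B ∧
    ∀ C : Set (E n), Convex ℝ C → SFree S C → B ⊆ C → B = C

/-- `B` is lattice-free: no integral point in its interior. -/
def LatticeFree {n : ℕ} (B : Set (E n)) : Prop := ∀ x ∈ interior B, ¬ IsIntPt x

/-- `B` is a maximal lattice-free convex set. -/
def MaxLatticeFree {n : ℕ} (B : Set (E n)) : Prop :=
  Convex ℝ B ∧ LatticeFree B ∧
    ∀ C : Set (E n), Convex ℝ C → LatticeFree C → B ⊆ C → B = C

/-- A polyhedron: finite intersection of closed half-spaces. -/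
def IsPolyhedron {n : ℕ} (B : Set (E n)) : Prop :=
  ∃ (m : ℕ) (a : Fin m → E n) (c : Fin m → ℝ), B = {x | ∀ i, dot (a i) x ≤ c i}

/-- A polytope: convex hull of finitely many points. -/
def IsPolytope {n : ℕ} (P : Set (E n)) : Prop :=
  ∃ V : Finset (E n), P = convexHull ℝ (V : Set (E n))

/-- Dimension of a set: dimension of its affine hull. -/
def sdim {n : ℕ} (A : Set (E n)) : ℕ := Module.finrank ℝ (affineSpan ℝ A).direction

/-- `F` is a face of the convex set `B`. -/
def IsFaceOf {n : ℕ} (F B : Set (E n)) : Prop :=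
  F ⊆ B ∧ Convex ℝ F ∧ ∀ x ∈ B, ∀ y ∈ B, ∀ t : ℝ, 0 < t → t < 1 →
    t • x + (1 - t) • y ∈ F → x ∈ F ∧ y ∈ F

/-- `F` is a facet of `B`: a nonempty face of dimension `dim B - 1`. -/
def IsFacetOf {n : ℕ} (F B : Set (E n)) : Prop :=
  IsFaceOf F B ∧ F.Nonempty ∧ sdim F + 1 = sdim B

/-- Recession cone of `K`. -/
def recCone {n : ℕ} (K : Set (E n)) : Set (E n) :=
  {d | ∀ x ∈ K, ∀ t : ℝ, 0 ≤ t → x + t • d ∈ K}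

/-- Lineality space of `K`. -/
def linSpace {n : ℕ} (K : Set (E n)) : Set (E n) :=
  {d | d ∈ recCone K ∧ -d ∈ recCone K}

/-- The set of all finite nonnegative combinations of elements of `G`. -/
def conicHullOf {n : ℕ} (G : Set (E n)) : Set (E n) :=
  {x | ∃ (m : ℕ) (c : Fin m → ℝ) (v : Fin m → E n),
    (∀ i, 0 ≤ c i) ∧ (∀ i, v i ∈ G) ∧ x = ∑ i, c i • v i}

/-- A cone is rational if it is generated by vectors with rational coordinates. -/
def IsRationalCone {n : ℕ} (C : Set (E n)) : Prop :=
  ∃ G : Set (E n), (∀ v ∈ G, IsRatVec v) ∧ C = conicHullOf G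

/-- A linear subspace is rational if it is spanned by rational vectors. -/
def IsRationalSubspace {n : ℕ} (L : Submodule ℝ (E n)) : Prop :=
  ∃ G : Set (E n), (∀ v ∈ G, IsRatVec v) ∧ L = Submodule.span ℝ G

/-- The hyperplane `{x | a·x = β}` is a supporting hyperplane of `C`. -/
def IsSupportingHyperplane {n : ℕ} (a : E n) (β : ℝ) (C : Set (E n)) : Prop :=
  ((∀ x ∈ C, dot a x ≤ β) ∨ (∀ x ∈ C, β ≤ dot a x)) ∧
    ∃ x ∈ closure C, dot a x = β

/-- `ψ` is a valid function with respect to `f` and `S`. -/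
def ValidFn {n : ℕ} (S : Set (E n)) (f : E n) (ψ : E n → ℝ) : Prop :=
  ∀ s : (E n) →₀ ℝ, (∀ r, 0 ≤ s r) →
    (f + s.sum fun r c => c • r) ∈ S →
    1 ≤ s.sum fun r c => ψ r * c

/-- Sublinear: positively homogeneous and subadditive. -/
def Sublinear {n : ℕ} (ψ : E n → ℝ) : Prop :=
  (∀ t : ℝ, 0 ≤ t → ∀ r, ψ (t • r) = t * ψ r) ∧
  (∀ r r', ψ (r + r') ≤ ψ r + ψ r')

/-- Polar of `K`. -/
def polar {n : ℕ} (K : Set (E n)) : Set (E n) := {y | ∀ r ∈ K, dot y r ≤ 1}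

/-- `K̂ = {y ∈ K* | ∃ x ∈ K, x·y = 1}`. -/
def Khat {n : ℕ} (K : Set (E n)) : Set (E n) :=
  {y | y ∈ polar K ∧ ∃ x ∈ K, dot x y = 1}

/-- `ρ_K(r) = sup { y·r | y ∈ K̂ }`. -/
def rho {n : ℕ} (K : Set (E n)) (r : E n) : ℝ :=
  sSup ((fun y => dot y r) '' Khat K)

section aux
open Filter Topology

lemma dot_eq_inner {n : ℕ} (x y : E n) : dot x y = inner ℝ x y := by
  simp [dot, PiLp.inner_apply, mul_comm]

lemma Sublinear.map_zero {n : ℕ} {q : E n → ℝ} (hq : Sublinear q) : q 0 = 0 := by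
  have := hq.1 0 le_rfl 0
  simpa using this

/-- Infimum construction of sublinear functions. -/
lemma sInf_sublinear {n : ℕ} (R : E n → Set ℝ) (hne : ∀ x, (R x).Nonempty)
    (h0 : ∀ a ∈ R 0, 0 ≤ a)
    (hs : ∀ x, ∀ a ∈ R x, ∀ t : ℝ, 0 < t → t * a ∈ R (t • x))
    (ha : ∀ x y, ∀ a ∈ R x, ∀ b ∈ R y, ∃ c ∈ R (x + y), c ≤ a + b)
    (hz : 0 ∈ R 0) :
    (∀ x, BddBelow (R x)) ∧ Sublinear (fun x => sInf (R x)) := by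
  have hb : ∀ x, BddBelow (R x) := by
    intro x
    obtain ⟨b0, hb0⟩ := hne (-x)
    refine ⟨-b0, fun a haR => ?_⟩
    obtain ⟨c, hc, hle⟩ := ha x (-x) a haR b0 hb0
    rw [add_neg_cancel] at hc
    have := h0 c hc
    linarith
  have key : ∀ t : ℝ, 0 < t → ∀ x, sInf (R (t • x)) ≤ t * sInf (R x) := by
    intro t ht x
    have : sInf (R (t • x)) / t ≤ sInf (R x) := by
      apply le_csInf (hne x)
      intro a haR
      rw [div_le_iff₀ ht, mul_comm]
      exact csInf_le (hb _) (hs x a haR t ht)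
    rw [div_le_iff₀ ht] at this
    linarith
  refine ⟨hb, ?_, ?_⟩
  · intro t ht r
    rcases ht.eq_or_lt with rfl | ht
    · simp only [zero_smul, zero_mul]
      exact le_antisymm (csInf_le (hb 0) hz) (le_csInf (hne 0) h0)
    · refine le_antisymm (key t ht r) ?_
      have h := key t⁻¹ (inv_pos.2 ht) (t • r)
      rw [smul_smul, inv_mul_cancel₀ ht.ne', one_smul] at h
      calc t * sInf (R r) ≤ t * (t⁻¹ * sInf (R (t • r))) := by gcongr
        _ = _ := by rw [← mul_assoc, mul_inv_cancel₀ ht.ne', one_mul]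
  · intro x y
    apply le_of_forall_pos_le_add
    intro ε hε
    obtain ⟨a, ha1, ha2⟩ := exists_lt_of_csInf_lt (hne x) (lt_add_of_pos_right (sInf (R x)) (half_pos hε))
    obtain ⟨b, hb1, hb2⟩ := exists_lt_of_csInf_lt (hne y) (lt_add_of_pos_right (sInf (R y)) (half_pos hε))
    obtain ⟨c, hc, hle⟩ := ha x y a ha1 b hb1
    have := csInf_le (hb _) hc
    simp only
    linarith

/-- minimal sublinear function covering `T` -/
structure MinV {n : ℕ} (T : Set (E n)) (q : E n → ℝ) : Prop where
  sub : Sublinear q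
  cov : ∀ x ∈ T, 1 ≤ q x
  min : ∀ q' : E n → ℝ, Sublinear q' → (∀ x ∈ T, 1 ≤ q' x) → (∀ x, q' x ≤ q x) →
    ∀ x, q x ≤ q' x

lemma exists_sub_of_valid {n : ℕ} (S : Set (E n)) (hS : S.Nonempty) (f : E n) (ψ : E n → ℝ)
    (hv : ValidFn S f ψ) :
    ∃ p : E n → ℝ, Sublinear p ∧ (∀ x, p x ≤ ψ x) ∧ ∀ s ∈ S, 1 ≤ p (s - f) := by
  classical
  let R : E n → Set ℝ := fun x => {a | ∃ s : (E n) →₀ ℝ, (∀ r, 0 ≤ s r) ∧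
    (s.sum fun r c => c • r) = x ∧ (s.sum fun r c => ψ r * c) = a}
  have hsingle : ∀ x, ψ x ∈ R x := by
    intro x
    refine ⟨Finsupp.single x 1, ?_, ?_, ?_⟩
    · intro r
      by_cases h : x = r
      · subst h; simp
      · simp [h]
    · rw [Finsupp.sum_single_index] <;> simp
    · rw [Finsupp.sum_single_index] <;> simp
  have hs : ∀ x, ∀ a ∈ R x, ∀ t : ℝ, 0 < t → t * a ∈ R (t • x) := by
    rintro x a ⟨s, h1, h2, h3⟩ t ht
    refine ⟨t • s, fun r => by simpa using mul_nonneg ht.le (h1 r), ?_, ?_⟩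
    · rw [Finsupp.sum_smul_index (by simp), ← h2, Finsupp.smul_sum]
      simp only [mul_smul]
    · rw [Finsupp.sum_smul_index (by simp), ← h3, Finsupp.mul_sum]
      refine Finsupp.sum_congr fun r _ => by ring
  have ha : ∀ x y, ∀ a ∈ R x, ∀ b ∈ R y, ∃ c ∈ R (x + y), c ≤ a + b := by
    rintro x y a ⟨s, h1, h2, h3⟩ b ⟨s', h1', h2', h3'⟩
    refine ⟨a + b, ⟨s + s', fun r => by simpa using add_nonneg (h1 r) (h1' r), ?_, ?_⟩, le_rfl⟩
    · rw [Finsupp.sum_add_index', h2, h2']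
      · simp
      · intros; rw [add_smul]
    · rw [Finsupp.sum_add_index', h3, h3']
      · simp
      · intros; ring
  have hval : ∀ s ∈ S, ∀ a ∈ R (s - f), 1 ≤ a := by
    rintro s hsS a ⟨σ, h1, h2, h3⟩
    rw [← h3]
    apply hv σ h1
    rw [h2]; simpa using hsS
  have h0 : ∀ a ∈ R 0, 0 ≤ a := by
    intro a haR
    by_contra hneg
    push Not at hneg
    obtain ⟨s0, hs0⟩ := hS
    obtain ⟨M, hM⟩ : ∃ M : ℝ, 0 < M ∧ ψ (s0 - f) + M * a < 1 := by
      refine ⟨(|ψ (s0 - f)| + 1) / (-a), by have := neg_pos.2 hneg; positivity, ?_⟩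
      have : (|ψ (s0 - f)| + 1) / (-a) * a = -(|ψ (s0 - f)| + 1) := by
        field_simp [hneg.ne]
      rw [this]
      have := le_abs_self (ψ (s0 - f))
      linarith
    have h1 := hs 0 a haR M hM.1
    obtain ⟨c, hc, hle⟩ := ha (s0 - f) (M • 0) _ (hsingle _) _ h1
    have := hval s0 hs0 c (by simpa using hc)
    linarith [hM.2]
  have hz : (0 : ℝ) ∈ R 0 := ⟨0, by simp, by simp, by simp⟩
  obtain ⟨hb, hsub⟩ := sInf_sublinear R (fun x => ⟨_, hsingle x⟩) h0 hs ha hz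
  exact ⟨_, hsub, fun x => csInf_le (hb x) (hsingle x),
    fun s hs => le_csInf ⟨_, hsingle _⟩ (hval s hs)⟩

lemma exists_minV {n : ℕ} (T : Set (E n)) (p : E n → ℝ) (hp : Sublinear p)
    (hc : ∀ x ∈ T, 1 ≤ p x) : ∃ q, MinV T q ∧ ∀ x, q x ≤ p x := by
  let Ω : Set (E n → ℝ)ᵒᵈ := {q | Sublinear (OrderDual.ofDual q) ∧
    ∀ x ∈ T, 1 ≤ (OrderDual.ofDual q) x}
  have hz := zorn_le_nonempty₀ Ω (by
    intro c hcΩ hchain y hy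
    let R : E n → Set ℝ := fun x => {a | ∃ q ∈ c, OrderDual.ofDual q x = a}
    have key := sInf_sublinear R (fun x => ⟨_, y, hy, rfl⟩)
      (by
        rintro a ⟨q, hq, rfl⟩
        exact (hcΩ hq).1.map_zero.ge)
      (by
        rintro x a ⟨q, hq, rfl⟩ t ht
        exact ⟨q, hq, (hcΩ hq).1.1 t ht.le x⟩)
      (by
        rintro x x' a ⟨q, hq, rfl⟩ b ⟨q', hq', rfl⟩
        rcases hchain.total hq hq' with h | h
        · refine ⟨_, ⟨q', hq', rfl⟩, ((hcΩ hq').1.2 x x').trans ?_⟩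
          have : OrderDual.ofDual q' x ≤ OrderDual.ofDual q x := h x
          linarith
        · refine ⟨_, ⟨q, hq, rfl⟩, ((hcΩ hq).1.2 x x').trans ?_⟩
          have : OrderDual.ofDual q x' ≤ OrderDual.ofDual q' x' := h x'
          linarith)
      ⟨y, hy, (hcΩ hy).1.map_zero⟩
    refine ⟨OrderDual.toDual fun x => sInf (R x), ⟨key.2, ?_⟩, ?_⟩
    · intro x hx
      refine le_csInf (s := R x) ⟨OrderDual.ofDual y x, y, hy, rfl⟩ ?_
      rintro a ⟨q, hq, rfl⟩
      exact (hcΩ hq).2 x hx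
    · intro q hq x
      exact csInf_le (key.1 x) ⟨q, hq, rfl⟩) (OrderDual.toDual p) ⟨hp, hc⟩
  obtain ⟨q, hle, hmax⟩ := hz
  refine ⟨OrderDual.ofDual q, ⟨hmax.1.1, hmax.1.2, ?_⟩, fun x => hle x⟩
  intro q' h1 h2 h3
  have := hmax.2 (y := OrderDual.toDual q') ⟨h1, h2⟩ h3
  exact this

lemma Sublinear.continuous {n : ℕ} {q : E n → ℝ} (hq : Sublinear q) : Continuous q := by
  have hconv : ConvexOn ℝ Set.univ q := by
    refine ⟨convex_univ, fun x _ y _ a b ha hb _ => ?_⟩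
    refine (hq.2 _ _).trans ?_
    rw [hq.1 a ha, hq.1 b hb]
    rfl
  have := hconv.continuousOn_interior
  simpa using this

lemma exists_support {n : ℕ} {q : E n → ℝ} (hq : Sublinear q) (x0 : E n) :
    ∃ d : E n, (∀ x, inner ℝ d x ≤ q x) ∧ inner ℝ d x0 = q x0 := by
  have main : ∀ g : E n →ₗ[ℝ] ℝ, (∀ x, g x ≤ q x) → g x0 = q x0 →
      ∃ d : E n, (∀ x, inner ℝ d x ≤ q x) ∧ inner ℝ d x0 = q x0 := by
    intro g h1 h2
    refine ⟨(InnerProductSpace.toDual ℝ (E n)).symm (LinearMap.toContinuousLinearMap g), ?_, ?_⟩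
    · intro x
      simpa using h1 x
    · simpa using h2
  by_cases hx : x0 = 0
  · subst hx
    obtain ⟨g, hg1, hg2⟩ := exists_extension_of_le_sublinear (⊥ : E n →ₗ.[ℝ] ℝ) q
      (fun c hc x => hq.1 c hc.le x) hq.2 (by
        rintro ⟨x, hx⟩
        have : x = 0 := (Submodule.mem_bot ℝ).1 hx
        subst this
        rw [hq.map_zero]
        exact le_of_eq (map_zero _))
    exact main g hg2 (by rw [hq.map_zero, map_zero])
  · obtain ⟨g, hg1, hg2⟩ := exists_extension_of_le_sublinear
      (LinearPMap.mkSpanSingleton (K := ℝ) x0 (q x0) hx) q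
      (fun c hc x => hq.1 c hc.le x) hq.2 (by
        rintro ⟨x, hx'⟩
        obtain ⟨c, rfl⟩ := Submodule.mem_span_singleton.1 hx'
        rw [LinearPMap.mkSpanSingleton'_apply]
        simp only [RingHom.id_apply]
        rcases le_total 0 c with h | h
        · rw [hq.1 c h]; simp
        · have h1 := hq.1 (-c) (by linarith) x0
          have h2 := hq.2 (c • x0) ((-c) • x0)
          rw [← add_smul, add_neg_cancel, zero_smul, hq.map_zero, h1] at h2
          simp only [smul_eq_mul]
          linarith)
    refine main g hg2 ?_
    have := hg1 ⟨x0, Submodule.mem_span_singleton_self x0⟩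
    rw [this]
    exact LinearPMap.mkSpanSingleton'_apply_self _ _ _ _

/-- lineality space of a sublinear function -/
def Lin {n : ℕ} (q : E n → ℝ) (hq : Sublinear q) : Submodule ℝ (E n) where
  carrier := {x | q x ≤ 0 ∧ q (-x) ≤ 0}
  zero_mem' := by simp [hq.map_zero]
  add_mem' := by
    rintro x y ⟨h1, h2⟩ ⟨h3, h4⟩
    refine ⟨(hq.2 _ _).trans (by linarith), ?_⟩
    rw [neg_add]
    exact (hq.2 _ _).trans (by linarith)
  smul_mem' := by
    rintro c x ⟨h1, h2⟩
    show q (c • x) ≤ 0 ∧ q (-(c • x)) ≤ 0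
    rcases le_total 0 c with h | h
    · rw [← smul_neg, hq.1 c h, hq.1 c h]
      exact ⟨mul_nonpos_of_nonneg_of_nonpos h h1, mul_nonpos_of_nonneg_of_nonpos h h2⟩
    · have e : c • x = (-c) • (-x) := by simp
      rw [← neg_smul, e, hq.1 (-c) (by linarith), hq.1 (-c) (by linarith)]
      exact ⟨mul_nonpos_of_nonneg_of_nonpos (by linarith) h2,
        mul_nonpos_of_nonneg_of_nonpos (by linarith) h1⟩

lemma mem_Lin {n : ℕ} {q : E n → ℝ} (hq : Sublinear q) (x : E n) :
    x ∈ Lin q hq ↔ q x ≤ 0 ∧ q (-x) ≤ 0 := Iff.rfl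

lemma Lin_inv {n : ℕ} {q : E n → ℝ} (hq : Sublinear q) {l : E n} (hl : l ∈ Lin q hq) (x : E n) :
    q (x + l) = q x := by
  obtain ⟨h1, h2⟩ := hl
  apply le_antisymm
  · exact (hq.2 _ _).trans (by linarith)
  · have := hq.2 (x + l) (-l)
    rw [add_neg_cancel_right] at this
    linarith

lemma Lin_inner {n : ℕ} {q : E n → ℝ} (hq : Sublinear q) {l : E n} (hl : l ∈ Lin q hq) {d : E n}
    (hd : ∀ x, inner ℝ d x ≤ q x) : inner ℝ d l = 0 := by
  obtain ⟨h1, h2⟩ := hl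
  have h3 := hd l
  have h4 := hd (-l)
  rw [inner_neg_right] at h4
  linarith

/-- invariance lemma -/
lemma MinV.inv {n : ℕ} {T : Set (E n)} {q : E n → ℝ} (h : MinV T q) (hT : T.Nonempty) (u : E n)
    (hu : ∀ s ∈ T, ∀ τ : ℝ, 1 ≤ q (s + τ • u)) : u ∈ Lin q h.sub := by
  have hq := h.sub
  let R : E n → Set ℝ := fun x => Set.range fun τ : ℝ => q (x + τ • u)
  obtain ⟨s0, hs0⟩ := hT
  have key := sInf_sublinear R (fun x => Set.range_nonempty _)
    (by
      rintro a ⟨τ, rfl⟩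
      simp only [zero_add]
      by_contra hneg
      push Not at hneg
      set a := q (τ • u)
      let M := (|q s0| + 1) / (-a)
      have hM : 0 < M := by have := neg_pos.2 hneg; positivity
      have h1 := hu s0 hs0 (M * τ)
      have h2 := hq.2 s0 ((M * τ) • u)
      rw [mul_smul, hq.1 M hM.le] at h2
      rw [mul_smul] at h1
      have h3 : M * a = -(|q s0| + 1) := by
        simp only [M]; field_simp [hneg.ne]
      have := le_abs_self (q s0)
      linarith)
    (by
      rintro x a ⟨τ, rfl⟩ t ht
      refine ⟨t * τ, ?_⟩
      simp only
      rw [mul_smul, ← smul_add, hq.1 t ht.le])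
    (by
      rintro x y a ⟨τ, rfl⟩ b ⟨τ', rfl⟩
      refine ⟨_, ⟨τ + τ', rfl⟩, ?_⟩
      simp only
      refine le_trans (le_of_eq ?_) (hq.2 _ _)
      congr 1
      module)
    ⟨0, by simp [hq.map_zero]⟩
  have hmin := h.min _ key.2
    (by
      intro x hx
      apply le_csInf (Set.range_nonempty _)
      rintro a ⟨τ, rfl⟩
      exact hu x hx τ)
    (by
      intro x
      exact csInf_le (key.1 x) ⟨0, by simp⟩)
  rw [mem_Lin]
  constructor
  · refine (hmin u).trans (csInf_le (key.1 u) ⟨-1, by simp [hq.map_zero]⟩)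
  · refine (hmin (-u)).trans (csInf_le (key.1 (-u)) ⟨1, by simp [hq.map_zero]⟩)

lemma IsIntPt.add {n : ℕ} {x y : E n} (hx : IsIntPt x) (hy : IsIntPt y) : IsIntPt (x + y) := by
  intro i
  obtain ⟨a, ha⟩ := hx i
  obtain ⟨b, hb⟩ := hy i
  exact ⟨a + b, by simp [ha, hb]⟩

lemma IsIntPt.zsmul {n : ℕ} {x : E n} (hx : IsIntPt x) (m : ℤ) : IsIntPt ((m : ℝ) • x) := by
  intro i
  obtain ⟨a, ha⟩ := hx i
  exact ⟨m * a, by simp [ha]⟩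

lemma IsIntPt.neg {n : ℕ} {x : E n} (hx : IsIntPt x) : IsIntPt (-x) := by
  intro i
  obtain ⟨a, ha⟩ := hx i
  exact ⟨-a, by simp [ha]⟩

lemma rat_gap {n : ℕ} (a : E n) (ha : IsRatVec a) :
    ∃ η : ℝ, 0 < η ∧ ∀ w : E n, IsIntPt w → |inner ℝ a w| < η → inner ℝ a w = 0 := by
  choose c hc using ha
  let N : ℕ := ∏ i, (c i).den
  have hN : 0 < N := Finset.prod_pos fun i _ => (c i).den_pos
  have hNR : (0 : ℝ) < N := by exact_mod_cast hN
  have hNa : ∀ i, ∃ m : ℤ, (N : ℝ) * a i = m := by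
    intro i
    obtain ⟨k, hk⟩ : (c i).den ∣ N := Finset.dvd_prod_of_mem _ (Finset.mem_univ i)
    refine ⟨k * (c i).num, ?_⟩
    rw [hc, hk]
    have : ((c i : ℚ) : ℝ) = (c i).num / (c i).den := by exact_mod_cast (Rat.num_div_den (c i)).symm
    rw [this]
    have h0 : ((c i).den : ℝ) ≠ 0 := by exact_mod_cast (c i).den_nz
    push_cast
    field_simp
  choose m hm using hNa
  refine ⟨1 / N, by positivity, ?_⟩
  intro w hw hlt
  choose z hz using hw
  have e : (N : ℝ) * inner ℝ a w = ((∑ i, m i * z i : ℤ) : ℝ) := by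
    rw [← dot_eq_inner, dot, Finset.mul_sum]
    push_cast
    refine Finset.sum_congr rfl fun i _ => ?_
    rw [← mul_assoc, hm, hz]
  have h1 : |((∑ i, m i * z i : ℤ) : ℝ)| < 1 := by
    rw [← e, abs_mul, abs_of_pos hNR]
    rw [lt_div_iff₀ hNR] at hlt
    linarith
  have h2 : (∑ i, m i * z i : ℤ) = 0 := by
    rw [← Int.abs_lt_one_iff]
    exact_mod_cast h1
  rw [h2] at e
  simp only [Int.cast_zero, mul_eq_zero] at e
  rcases e with e | e
  · exact absurd e hNR.ne'
  · exact e

lemma rec_seq {n : ℕ} (v : E n) : ∃ (t : ℕ → ℝ) (w : ℕ → E n), (∀ k, IsIntPt (w k)) ∧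
    Tendsto t atTop atTop ∧ Tendsto (fun k => w k - t k • v) atTop (𝓝 0) := by
  let x : ℕ → (Fin n → ℝ) := fun k i => Int.fract ((k : ℝ) * v i)
  have hx : ∀ k, x k ∈ Set.Icc (0 : Fin n → ℝ) 1 := fun k =>
    ⟨fun i => Int.fract_nonneg _, fun i => (Int.fract_lt_one _).le⟩
  obtain ⟨a, -, φ, hφ, hlim⟩ := isCompact_Icc.tendsto_subseq hx
  have hlim2 : Tendsto (fun k => x (φ (2 * k))) atTop (𝓝 a) :=
    hlim.comp (tendsto_atTop_mono (fun k => by show k ≤ 2 * k; omega) tendsto_id : Tendsto (fun k : ℕ => 2 * k) atTop atTop)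
  have hdiff : Tendsto (fun k => x (φ k) - x (φ (2 * k))) atTop (𝓝 0) := by
    have := Tendsto.sub hlim hlim2
    simpa using this
  have hφ2 : ∀ j k, φ j + k ≤ φ (j + k) := by
    intro j k
    induction k with
    | zero => simp
    | succ k ih =>
      have := hφ (show j + k < j + (k + 1) by omega)
      omega
  refine ⟨fun k => (φ (2 * k) : ℝ) - φ k,
    fun k => WithLp.toLp 2 fun i => ((⌊(φ (2 * k) : ℝ) * v i⌋ - ⌊(φ k : ℝ) * v i⌋ : ℤ) : ℝ), ?_, ?_, ?_⟩
  · intro k i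
    exact ⟨_, rfl⟩
  · refine tendsto_atTop_mono (fun k => ?_) tendsto_natCast_atTop_atTop
    have := hφ2 k k
    rw [← two_mul] at this
    have h : ((φ k + k : ℕ) : ℝ) ≤ φ (2 * k) := by exact_mod_cast this
    push_cast at h
    linarith
  · have hc : Continuous (fun y : Fin n → ℝ => (WithLp.toLp 2 y : E n)) :=
      PiLp.continuous_toLp 2 _
    have := (hc.tendsto 0).comp hdiff
    have e0 : (WithLp.toLp 2 (0 : Fin n → ℝ) : E n) = 0 := rfl
    rw [e0] at this
    refine this.congr fun k => ?_
    ext i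
    simp only [Function.comp, Pi.sub_apply, PiLp.sub_apply, PiLp.smul_apply, smul_eq_mul, x, Int.fract]
    push_cast
    ring

/-- the translated set -/
def TT {n m : ℕ} (f : E n) (A : Fin m → E n) (b : Fin m → ℝ) : Set (E n) :=
  {x | IsIntPt (x + f) ∧ ∀ i, inner ℝ (A i) x ≤ b i}

lemma tendsto_inner_of {n : ℕ} (a v : E n) (t : ℕ → ℝ) (w : ℕ → E n)
    (hw : Tendsto (fun k => w k - t k • v) atTop (𝓝 0)) :
    Tendsto (fun k => inner ℝ a (w k) - t k * inner ℝ a v) atTop (𝓝 0) := by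
  have h : Tendsto (fun k => inner ℝ a (w k - t k • v)) atTop (𝓝 (inner ℝ a 0)) :=
    Tendsto.inner tendsto_const_nhds hw
  simpa [inner_sub_right, inner_smul_right] using h

lemma rec_seq2 {n m : ℕ} (A : Fin m → E n) (hA : ∀ i, IsRatVec (A i)) (v : E n) :
    ∃ (t : ℕ → ℝ) (w : ℕ → E n), (∀ k, IsIntPt (w k)) ∧
    Tendsto t atTop atTop ∧ Tendsto (fun k => w k - t k • v) atTop (𝓝 0) ∧
    (∀ i, inner ℝ (A i) v = 0 → ∀ᶠ k in atTop, inner ℝ (A i) (w k) = 0) ∧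
    (∀ i, inner ℝ (A i) v < 0 → Tendsto (fun k => inner ℝ (A i) (w k)) atTop atBot) := by
  obtain ⟨t, w, h1, h2, h3⟩ := rec_seq v
  refine ⟨t, w, h1, h2, h3, ?_, ?_⟩
  · intro i hi
    obtain ⟨η, hη, hgap⟩ := rat_gap (A i) (hA i)
    have h := tendsto_inner_of (A i) v t w h3
    simp only [hi, mul_zero, sub_zero] at h
    have := h.eventually (Metric.ball_mem_nhds 0 hη)
    filter_upwards [this] with k hk
    apply hgap _ (h1 k)
    simpa using hk
  · intro i hi
    have h := tendsto_inner_of (A i) v t w h3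
    have h' : Tendsto (fun k => t k * inner ℝ (A i) v) atTop atBot :=
      h2.atTop_mul_const_of_neg hi
    have := h'.atBot_add h
    refine this.congr fun k => ?_
    ring

/-- key validity propagation -/
lemma key_prop {n m : ℕ} {f : E n} {A : Fin m → E n} {b : Fin m → ℝ} (hA : ∀ i, IsRatVec (A i))
    {q : E n → ℝ} (hq : Sublinear q) (hcov : ∀ x ∈ TT f A b, 1 ≤ q x)
    {v : E n} (hv : ∀ i, inner ℝ (A i) v ≤ 0) (hqv : q v ≤ 0)
    {y : E n} (hy : IsIntPt (y + f)) (hyb : ∀ i, inner ℝ (A i) v = 0 → inner ℝ (A i) y ≤ b i)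
    (τ : ℝ) : 1 ≤ q (y + τ • v) := by
  obtain ⟨t, w, h1, h2, h3, h4, h5⟩ := rec_seq2 A hA v
  have hmem : ∀ᶠ k in atTop, y + w k ∈ TT f A b := by
    have hall : ∀ i, ∀ᶠ k in atTop, inner ℝ (A i) (y + w k) ≤ b i := by
      intro i
      rcases (hv i).eq_or_lt with h | h
      · filter_upwards [h4 i h] with k hk
        rw [inner_add_right, hk, add_zero]
        exact hyb i h
      · filter_upwards [(h5 i h).eventually_le_atBot (b i - inner ℝ (A i) y)] with k hk
        rw [inner_add_right]
        linarith
    filter_upwards [eventually_all.2 hall] with k hk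
    refine ⟨?_, hk⟩
    rw [add_right_comm]
    exact hy.add (h1 k)
  have hlim : Tendsto (fun k => q (y + τ • v) + q (w k - t k • v)) atTop (𝓝 (q (y + τ • v) + q 0)) :=
    tendsto_const_nhds.add ((hq.continuous.tendsto 0).comp h3)
  rw [hq.map_zero, add_zero] at hlim
  refine ge_of_tendsto hlim ?_
  filter_upwards [hmem, h2.eventually_ge_atTop τ] with k hk hτ
  have e : y + w k = (y + τ • v + (w k - t k • v)) + (t k - τ) • v := by module
  have h6 := hcov _ hk
  have h7 := hq.2 (y + τ • v + (w k - t k • v)) ((t k - τ) • v)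
  have h8 := hq.2 (y + τ • v) (w k - t k • v)
  rw [← e, hq.1 (t k - τ) (by linarith)] at h7
  have h9 : (t k - τ) * q v ≤ 0 := mul_nonpos_of_nonneg_of_nonpos (by linarith) hqv
  linarith

lemma lemma1 {n m : ℕ} {f : E n} {A : Fin m → E n} {b : Fin m → ℝ} (hA : ∀ i, IsRatVec (A i))
    {q : E n → ℝ} (h : MinV (TT f A b) q) (hT : (TT f A b).Nonempty)
    {v : E n} (hv : ∀ i, inner ℝ (A i) v ≤ 0) (hqv : q v ≤ 0) : v ∈ Lin q h.sub :=
  h.inv hT v fun _ hs τ => key_prop hA h.sub h.cov hv hqv hs.1 (fun i _ => hs.2 i) τ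

lemma lemma2 {n m : ℕ} {f : E n} {A : Fin m → E n} {b : Fin m → ℝ} (hA : ∀ i, IsRatVec (A i))
    {q : E n → ℝ} (h : MinV (TT f A b) q) (hT : (TT f A b).Nonempty)
    {v : E n} (hv : ∀ i, inner ℝ (A i) v ≤ 0) (hvL : v ∈ Lin q h.sub)
    (t : ℕ → ℝ) (w : ℕ → E n) (hw : ∀ k, IsIntPt (w k))
    (hlim : Tendsto (fun k => w k - t k • v) atTop (𝓝 0))
    (hz : ∀ k i, inner ℝ (A i) v = 0 → inner ℝ (A i) (w k) = 0) :
    ∃ k, w k ∈ Lin q h.sub := by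
  by_contra hcon
  push Not at hcon
  have hq := h.sub
  set L := Lin q h.sub with hL
  let P : E n →L[ℝ] E n := Lᗮ.starProjection
  have hPL : ∀ x, x - P x ∈ L := by
    intro x
    have := Submodule.sub_starProjection_mem_orthogonal (K := Lᗮ) x
    rwa [Submodule.orthogonal_orthogonal] at this
  have hPm : ∀ x, P x ∈ Lᗮ := fun x => Submodule.starProjection_apply_mem _ x
  have hPv : P v = 0 := by
    have h1 : P v ∈ L := by
      have := L.sub_mem hvL (hPL v)
      simpa using this
    exact Submodule.disjoint_def.1 L.orthogonal_disjoint _ h1 (hPm v)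
  have hPw : ∀ k, P (w k) ≠ 0 := by
    intro k h0
    have := hPL (w k)
    rw [h0, sub_zero] at this
    exact hcon k this
  have hPlim : Tendsto (fun k => P (w k)) atTop (𝓝 0) := by
    have := (P.continuous.tendsto 0).comp hlim
    simp only [map_zero] at this
    refine this.congr fun k => ?_
    simp [hPv]
  let u : ℕ → E n := fun k => ‖P (w k)‖⁻¹ • P (w k)
  have hu : ∀ k, u k ∈ Metric.sphere (0 : E n) 1 := by
    intro k
    simp only [u, mem_sphere_zero_iff_norm, norm_smul, norm_inv, norm_norm]
    exact inv_mul_cancel₀ (norm_ne_zero_iff.2 (hPw k))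
  obtain ⟨u0, hu0, φ, hφ, hul⟩ := (isCompact_sphere (0 : E n) 1).tendsto_subseq hu
  have hu0L : u0 ∈ Lᗮ := by
    have hcl : IsClosed (Lᗮ : Set (E n)) := Submodule.closed_of_finiteDimensional _
    refine hcl.mem_of_tendsto hul (Eventually.of_forall fun k => ?_)
    exact Lᗮ.smul_mem _ (hPm _)
  have hmem : u0 ∈ L := by
    apply h.inv hT
    intro s hs τ
    let N : ℕ → ℤ := fun k => ⌊τ / ‖P (w (φ k))‖⌋
    have hN1 : ∀ k, 1 ≤ q (s + (N k : ℝ) • P (w (φ k))) := by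
      intro k
      have h1 := key_prop (y := s + (N k : ℝ) • w (φ k)) hA hq h.cov hv hvL.1 (by
        rw [add_right_comm]
        exact hs.1.add ((hw _).zsmul _)) (by
        intro i hi
        rw [inner_add_right, inner_smul_right, hz _ i hi, mul_zero, add_zero]
        exact hs.2 i) 0
      have e : s + (N k : ℝ) • w (φ k) + (0 : ℝ) • v = s + (N k : ℝ) • P (w (φ k)) +
        (N k : ℝ) • (w (φ k) - P (w (φ k))) := by module
      rw [e, Lin_inv hq (L.smul_mem _ (hPL _))] at h1
      exact h1
    have hpos : ∀ k, 0 < ‖P (w (φ k))‖ := fun k => norm_pos_iff.2 (hPw _)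
    have hnl : Tendsto (fun k => ‖P (w (φ k))‖) atTop (𝓝 0) := by
      have := (hPlim.comp hφ.tendsto_atTop).norm
      simpa using this
    have hNl : Tendsto (fun k => (N k : ℝ) * ‖P (w (φ k))‖) atTop (𝓝 τ) := by
      have hlow : Tendsto (fun k => τ - ‖P (w (φ k))‖) atTop (𝓝 τ) := by
        simpa using tendsto_const_nhds.sub hnl
      refine tendsto_of_tendsto_of_tendsto_of_le_of_le hlow tendsto_const_nhds ?_ ?_
      · intro k
        have h1 := Int.lt_floor_add_one (τ / ‖P (w (φ k))‖)
        rw [div_lt_iff₀ (hpos k)] at h1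
        simp only [N]
        linarith
      · intro k
        have h1 := Int.floor_le (τ / ‖P (w (φ k))‖)
        rwa [le_div_iff₀ (hpos k)] at h1
    have hfin : Tendsto (fun k => s + (N k : ℝ) • P (w (φ k))) atTop (𝓝 (s + τ • u0)) := by
      refine tendsto_const_nhds.add ?_
      refine (hNl.smul hul).congr fun k => ?_
      simp only [Function.comp, u, smul_smul]
      rw [mul_assoc, mul_inv_cancel₀ (hpos k).ne', mul_one]
    exact ge_of_tendsto ((hq.continuous.tendsto _).comp hfin) (Eventually.of_forall hN1)
  have h0 := Submodule.disjoint_def.1 L.orthogonal_disjoint _ hmem hu0L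
  rw [h0] at hu0
  simp at hu0

lemma finite_int_ball {n : ℕ} (f : E n) (R : ℝ) :
    {x : E n | IsIntPt (x + f) ∧ ‖x‖ ≤ R}.Finite := by
  obtain ⟨N, hN⟩ := exists_nat_ge (R + ‖f‖)
  have hfin : (Set.Icc (fun _ => -(N : ℤ)) (fun _ => (N : ℤ)) : Set (Fin n → ℤ)).Finite :=
    Set.finite_Icc _ _
  refine (hfin.image fun z => (WithLp.toLp 2 (fun i => (z i : ℝ)) : E n) - f).subset ?_
  rintro x ⟨hx, hxR⟩
  choose z hz using hx
  have hb : ∀ i, |(z i : ℝ)| ≤ N := by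
    intro i
    rw [← hz i, ← Real.norm_eq_abs]
    calc ‖(x + f) i‖ ≤ ‖x + f‖ := PiLp.norm_apply_le _ i
      _ ≤ ‖x‖ + ‖f‖ := norm_add_le _ _
      _ ≤ N := by linarith
  refine ⟨z, ⟨fun i => ?_, fun i => ?_⟩, ?_⟩
  · have := (abs_le.1 (hb i)).1
    exact_mod_cast this
  · have := (abs_le.1 (hb i)).2
    exact_mod_cast this
  · ext i
    have := hz i
    simp only [PiLp.add_apply] at this
    simp [← this]

/-- coset-minimal points -/
def T0 {n : ℕ} (T : Set (E n)) (L : Submodule ℝ (E n)) : Set (E n) :=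
  {s | s ∈ T ∧ ∀ s' ∈ T, s' - s ∈ L → ‖s‖ ≤ ‖s'‖}

lemma exists_T0 {n m : ℕ} {f : E n} {A : Fin m → E n} {b : Fin m → ℝ} (L : Submodule ℝ (E n))
    {s : E n} (hs : s ∈ TT f A b) : ∃ s0 ∈ T0 (TT f A b) L, s0 - s ∈ L := by
  let X : Set (E n) := {x | x ∈ TT f A b ∧ x - s ∈ L ∧ ‖x‖ ≤ ‖s‖}
  have hX : X.Finite := (finite_int_ball f ‖s‖).subset fun x hx => ⟨hx.1.1, hx.2.2⟩
  obtain ⟨s0, hs0, hmin⟩ := Set.exists_min_image X (fun x => ‖x‖) hX ⟨s, hs, by simp, le_rfl⟩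
  refine ⟨s0, ⟨hs0.1, ?_⟩, hs0.2.1⟩
  intro s' hs' hL
  by_cases h : ‖s'‖ ≤ ‖s‖
  · refine hmin s' ⟨hs', ?_, h⟩
    have := L.add_mem hL hs0.2.1
    simpa using this
  · push Not at h
    exact hs0.2.2.trans h.le

lemma exists_w {n m : ℕ} {f : E n} {A : Fin m → E n} {b : Fin m → ℝ} (hA : ∀ i, IsRatVec (A i))
    {q : E n → ℝ} (h : MinV (TT f A b) q) (hT : (TT f A b).Nonempty)
    {v : E n} (hv : ∀ i, inner ℝ (A i) v ≤ 0) (hvL : v ∈ Lin q h.sub) (hv0 : v ≠ 0) :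
    ∃ w, IsIntPt w ∧ w ∈ Lin q h.sub ∧ 0 < inner ℝ v w ∧
      ∀ i, inner ℝ (A i) v = 0 → inner ℝ (A i) w = 0 := by
  obtain ⟨t, w, h1, h2, h3, h4, -⟩ := rec_seq2 A hA v
  have h6 : Tendsto (fun k => inner ℝ v (w k)) atTop atTop := by
    have ha := tendsto_inner_of v v t w h3
    have hpos : 0 < inner ℝ v v := real_inner_self_pos.2 hv0
    have h' : Tendsto (fun k => t k * inner ℝ v v) atTop atTop := h2.atTop_mul_const hpos
    refine (h'.atTop_add ha).congr fun k => ?_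
    ring
  have hev : ∀ᶠ k in atTop, (∀ i, inner ℝ (A i) v = 0 → inner ℝ (A i) (w k) = 0) ∧
      0 < inner ℝ v (w k) := by
    refine Filter.Eventually.and (eventually_all.2 fun i => ?_) (h6.eventually_gt_atTop 0)
    by_cases hi : inner ℝ (A i) v = 0
    · filter_upwards [h4 i hi] with k hk _ using hk
    · exact Eventually.of_forall fun k hk => absurd hk hi
  obtain ⟨K, hK⟩ := eventually_atTop.1 hev
  obtain ⟨k, hk⟩ := lemma2 hA h hT hv hvL (fun k => t (k + K)) (fun k => w (k + K))
    (fun k => h1 _) (h3.comp (tendsto_add_atTop_nat K)) (fun k => (hK (k + K) (by omega)).1)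
  exact ⟨w (k + K), h1 _, hk, (hK (k + K) (by omega)).2, (hK (k + K) (by omega)).1⟩

lemma lemmaH {n m : ℕ} {f : E n} {A : Fin m → E n} {b : Fin m → ℝ} (hA : ∀ i, IsRatVec (A i))
    {q : E n → ℝ} (h : MinV (TT f A b) q) (hT : (TT f A b).Nonempty) :
    ∃ δ : ℝ, 0 < δ ∧ ∃ R : ℝ, ∀ s ∈ T0 (TT f A b) (Lin q h.sub), R ≤ ‖s‖ → δ * ‖s‖ ≤ q s := by
  by_contra hcon
  push Not at hcon
  have hq := h.sub
  have hch : ∀ j : ℕ, ∃ s ∈ T0 (TT f A b) (Lin q h.sub), (j : ℝ) + 1 ≤ ‖s‖ ∧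
      q s < 1 / ((j : ℝ) + 1) * ‖s‖ := fun j => hcon _ (by positivity) _
  choose s hs hsn hsq using hch
  have hpos : ∀ j, 0 < ‖s j‖ := fun j => lt_of_lt_of_le (by positivity) (hsn j)
  have hntop : Tendsto (fun j => ‖s j‖) atTop atTop :=
    tendsto_atTop_mono hsn (tendsto_atTop_add_const_right _ _ tendsto_natCast_atTop_atTop)
  let u : ℕ → E n := fun k => ‖s k‖⁻¹ • s k
  have hu : ∀ k, u k ∈ Metric.sphere (0 : E n) 1 := by
    intro k
    simp only [u, mem_sphere_zero_iff_norm, norm_smul, norm_inv, norm_norm]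
    exact inv_mul_cancel₀ (hpos k).ne'
  obtain ⟨r, hr, φ, hφ, hul⟩ := (isCompact_sphere (0 : E n) 1).tendsto_subseq hu
  have hr0 : r ≠ 0 := by
    rintro rfl
    simp at hr
  have hn2 : Tendsto (fun j => ‖s (φ j)‖) atTop atTop := hntop.comp hφ.tendsto_atTop
  have hin : ∀ a : E n, Tendsto (fun j => inner ℝ a (u (φ j))) atTop (𝓝 (inner ℝ a r)) :=
    fun a => Tendsto.inner tendsto_const_nhds hul
  have hse : ∀ j, s j = ‖s j‖ • u j := by
    intro j
    simp only [u, smul_smul]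
    rw [mul_inv_cancel₀ (hpos j).ne', one_smul]
  have hAr : ∀ i, inner ℝ (A i) r ≤ 0 := by
    intro i
    have hb : Tendsto (fun j => ‖s (φ j)‖⁻¹ * b i) atTop (𝓝 0) := by
      simpa using (tendsto_inv_atTop_zero.comp hn2).mul_const (b i)
    refine le_of_tendsto_of_tendsto' (hin (A i)) hb fun j => ?_
    simp only [u, inner_smul_right]
    exact mul_le_mul_of_nonneg_left ((hs (φ j)).1.2 i) (inv_nonneg.2 (norm_nonneg _))
  have hqr : q r ≤ 0 := by
    have hb : Tendsto (fun j => 1 / ((φ j : ℝ) + 1)) atTop (𝓝 0) :=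
      tendsto_one_div_add_atTop_nhds_zero_nat.comp hφ.tendsto_atTop
    refine le_of_tendsto_of_tendsto' ((hq.continuous.tendsto r).comp hul) hb fun j => ?_
    simp only [Function.comp, u]
    rw [hq.1 _ (inv_nonneg.2 (norm_nonneg _)), inv_mul_le_iff₀ (hpos _), mul_comm]
    exact (hsq _).le
  have hrL := lemma1 hA h hT hAr hqr
  obtain ⟨w, hw1, hw2, hw3, hw4⟩ := exists_w hA h hT hAr hrL hr0
  have hmem : ∀ᶠ j in atTop, s (φ j) - w ∈ TT f A b := by
    have hall : ∀ i, ∀ᶠ j in atTop, inner ℝ (A i) (s (φ j) - w) ≤ b i := by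
      intro i
      rcases (hAr i).eq_or_lt with hi | hi
      · refine Eventually.of_forall fun j => ?_
        rw [inner_sub_right, hw4 i hi, sub_zero]
        exact (hs _).1.2 i
      · have hbot := hn2.atTop_mul_neg hi (hin (A i))
        filter_upwards [hbot.eventually_le_atBot (b i + inner ℝ (A i) w)] with j hj
        rw [inner_sub_right, hse, inner_smul_right]
        linarith
    filter_upwards [eventually_all.2 hall] with j hj
    refine ⟨?_, hj⟩
    have := (hs (φ j)).1.1.add hw1.neg
    rwa [add_right_comm, ← sub_eq_add_neg] at this
  have hlt : ∀ᶠ j in atTop, ‖s (φ j) - w‖ < ‖s (φ j)‖ := by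
    have hw3' : 0 < inner ℝ w r := by rwa [real_inner_comm]
    have htop := hn2.atTop_mul_pos hw3' (hin w)
    filter_upwards [htop.eventually_gt_atTop (‖w‖ ^ 2)] with j hj
    have e : inner ℝ (s (φ j)) w = ‖s (φ j)‖ * inner ℝ w (u (φ j)) := by
      rw [real_inner_comm, ← inner_smul_right, ← hse]
    rw [← e] at hj
    have h2 := norm_sub_sq_real (s (φ j)) w
    refine lt_of_pow_lt_pow_left₀ 2 (norm_nonneg _) ?_
    have := sq_nonneg ‖w‖
    linarith
  obtain ⟨j, hj1, hj2⟩ := (hmem.and hlt).exists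
  have := (hs (φ j)).2 _ hj1 (by
    have := (Lin q h.sub).neg_mem hw2
    simpa using this)
  linarith

/-- finite covering families -/
def CovF {n : ℕ} (T : Set (E n)) (q : E n → ℝ) (F : Finset (E n)) : Prop :=
  (∀ d ∈ F, ∀ x, inner ℝ d x ≤ q x) ∧ ∀ s ∈ T, ∃ d ∈ F, 1 ≤ inner ℝ d s

lemma exists_CovF {n m : ℕ} {f : E n} {A : Fin m → E n} {b : Fin m → ℝ} (hA : ∀ i, IsRatVec (A i))
    {q : E n → ℝ} (h : MinV (TT f A b) q) (hT : (TT f A b).Nonempty) :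
    ∃ F, CovF (TT f A b) q F := by
  classical
  have hq := h.sub
  obtain ⟨δ, hδ, R, hR⟩ := lemmaH hA h hT
  choose D hD1 hD2 using fun x => exists_support hq x
  have hK : IsCompact (Metric.sphere (0 : E n) 1 ∩ {x | δ ≤ q x}) :=
    (isCompact_sphere 0 1).inter_right (isClosed_le continuous_const hq.continuous)
  obtain ⟨c, hc1, hc2⟩ := hK.elim_finite_subcover_image
    (b := Set.univ) (c := fun x : E n => {y : E n | δ / 2 < inner ℝ (D x) y})
    (fun x _ => isOpen_lt continuous_const (by fun_prop)) (by
      rintro x ⟨-, hx⟩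
      refine Set.mem_biUnion (Set.mem_univ x) ?_
      have hx' : δ ≤ q x := hx
      show δ / 2 < inner ℝ (D x) x
      rw [hD2]
      linarith)
  obtain ⟨hcfin, hcov⟩ := hc2
  let R' := max R (max 1 (2 / δ))
  have hfin := finite_int_ball f R'
  refine ⟨(hcfin.toFinset.image D) ∪ (hfin.toFinset.image D), ?_, ?_⟩
  · intro d hd x
    rcases Finset.mem_union.1 hd with hd | hd <;>
    · obtain ⟨y, -, rfl⟩ := Finset.mem_image.1 hd
      exact hD1 y x
  · intro s hs
    obtain ⟨s0, hs0, hL⟩ := exists_T0 (Lin q h.sub) hs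
    have hinv : ∀ y, inner ℝ (D y) s = inner ℝ (D y) s0 := by
      intro y
      have := Lin_inner hq hL (hD1 y)
      rw [inner_sub_right] at this
      linarith
    by_cases hle : ‖s0‖ ≤ R'
    · refine ⟨D s0, Finset.mem_union_right _ (Finset.mem_image_of_mem _ ?_), ?_⟩
      · rw [Set.Finite.mem_toFinset]
        exact ⟨hs0.1.1, hle⟩
      · rw [hinv, hD2]
        exact h.cov _ hs0.1
    · push Not at hle
      have hb1 : R ≤ ‖s0‖ := (le_max_left _ _).trans hle.le
      have hb2 : 1 ≤ ‖s0‖ := ((le_max_left _ _).trans (le_max_right _ _)).trans hle.le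
      have hb3 : 2 / δ ≤ ‖s0‖ := ((le_max_right _ _).trans (le_max_right _ _)).trans hle.le
      have hpos : 0 < ‖s0‖ := by linarith
      have hH := hR s0 hs0 hb1
      have hmem : ‖s0‖⁻¹ • s0 ∈ Metric.sphere (0 : E n) 1 ∩ {x | δ ≤ q x} := by
        constructor
        · simp only [mem_sphere_zero_iff_norm, norm_smul, norm_inv, norm_norm]
          exact inv_mul_cancel₀ hpos.ne'
        · show δ ≤ q _
          rw [hq.1 _ (inv_nonneg.2 (norm_nonneg _)), le_inv_mul_iff₀ hpos, mul_comm]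
          exact hH
      obtain ⟨x, hx, hxs⟩ := Set.mem_iUnion₂.1 (hcov hmem)
      refine ⟨D x, Finset.mem_union_left _ (Finset.mem_image_of_mem _ ?_), ?_⟩
      · simpa using hx
      · have hxs' : δ / 2 < inner ℝ (D x) (‖s0‖⁻¹ • s0) := hxs
        rw [inner_smul_right, lt_inv_mul_iff₀ hpos] at hxs'
        rw [hinv]
        rw [div_le_iff₀ hδ] at hb3
        linarith

lemma CovF.attain {n : ℕ} {T : Set (E n)} {q : E n → ℝ} (h : MinV T q) (hT : T.Nonempty)
    {F : Finset (E n)} (hF : CovF T q F) (x : E n) : ∃ d ∈ F, inner ℝ d x = q x := by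
  have hne : F.Nonempty := by
    obtain ⟨s, hs⟩ := hT
    obtain ⟨d, hd, -⟩ := hF.2 s hs
    exact ⟨d, hd⟩
  let q' : E n → ℝ := fun x => F.sup' hne fun d => inner ℝ d x
  have hatt : ∀ x, ∃ d ∈ F, q' x = inner ℝ d x := fun x => Finset.exists_mem_eq_sup' hne _
  have hle : ∀ x, ∀ d ∈ F, inner ℝ d x ≤ q' x := fun x d hd =>
    Finset.le_sup' (fun d => inner ℝ d x) hd
  have hsub : Sublinear q' := by
    constructor
    · intro t ht r
      apply le_antisymm
      · obtain ⟨d, hd, e⟩ := hatt (t • r)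
        rw [e, inner_smul_right]
        exact mul_le_mul_of_nonneg_left (hle r d hd) ht
      · obtain ⟨d, hd, e⟩ := hatt r
        rw [e, ← inner_smul_right]
        exact hle _ d hd
    · intro r r'
      obtain ⟨d, hd, e⟩ := hatt (r + r')
      rw [e, inner_add_right]
      exact add_le_add (hle r d hd) (hle r' d hd)
  have hmin := h.min q' hsub
    (by
      intro s hs
      obtain ⟨d, hd, h1⟩ := hF.2 s hs
      exact h1.trans (hle s d hd))
    (by
      intro y
      obtain ⟨d, hd, e⟩ := hatt y
      rw [e]
      exact hF.1 d hd y)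
  obtain ⟨d, hd, e⟩ := hatt x
  exact ⟨d, hd, le_antisymm (hF.1 d hd x) (by rw [← e]; exact hmin x)⟩

lemma lemma5 {n m : ℕ} {f : E n} {A : Fin m → E n} {b : Fin m → ℝ} (hA : ∀ i, IsRatVec (A i))
    {q : E n → ℝ} (h : MinV (TT f A b) q) (hT : (TT f A b).Nonempty)
    (h0 : (0 : E n) ∈ convexHull ℝ (TT f A b))
    {F : Finset (E n)} (hF : CovF (TT f A b) q F)
    (hmin : ∀ F', CovF (TT f A b) q F' → F.card ≤ F'.card) {d : E n} (hd : d ∈ F) :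
    ∃ s ∈ TT f A b, inner ℝ d s = 1 ∧ ∀ d' ∈ F, d' ≠ d → inner ℝ d' s < 1 := by
  classical
  by_contra hcon
  push Not at hcon
  have hq := h.sub
  have hTd : ∀ s ∈ TT f A b, (∀ d' ∈ F, d' ≠ d → inner ℝ d' s < 1) →
      inner ℝ d s = q s ∧ 1 < inner ℝ d s := by
    intro s hs hlt
    obtain ⟨d1, hd1, e⟩ := hF.attain h hT s
    have hge := h.cov s hs
    have hdd : d1 = d := by
      by_contra hne
      have := hlt d1 hd1 hne
      linarith
    subst hdd
    refine ⟨e, lt_of_le_of_ne (by linarith) fun he => ?_⟩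
    obtain ⟨d', h1, h2, h3⟩ := hcon s hs he.symm
    have := hlt d' h1 h2
    linarith
  obtain ⟨s1, hs1, hs1lt⟩ : ∃ s ∈ TT f A b, ∀ d' ∈ F, d' ≠ d → inner ℝ d' s < 1 := by
    by_contra hno
    push Not at hno
    have := hmin (F.erase d) ⟨fun d' hd' => hF.1 d' (Finset.mem_of_mem_erase hd'), fun s hs => by
      obtain ⟨d', h1, h2, h3⟩ := hno s hs
      exact ⟨d', Finset.mem_erase.2 ⟨h2, h1⟩, h3⟩⟩
    have hlt := Finset.card_erase_lt_of_mem hd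
    omega
  obtain ⟨dj, hdj, hdjne⟩ : ∃ dj ∈ F, dj ≠ d := by
    by_contra hno
    push Not at hno
    have hsub : TT f A b ⊆ {x | 1 ≤ inner ℝ d x} := by
      intro s hs
      obtain ⟨d', h1, h2⟩ := hF.2 s hs
      rw [hno d' h1] at h2
      exact h2
    have hconv : Convex ℝ {x : E n | 1 ≤ inner ℝ d x} :=
      convex_halfSpace_ge (innerₛₗ ℝ d).isLinear 1
    have := convexHull_min hsub hconv h0
    replace this : (1:ℝ) ≤ inner ℝ d 0 := this
    rw [inner_zero_right] at this
    linarith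
  obtain ⟨δ, hδ, R, hR⟩ := lemmaH hA h hT
  let R' := max R (2 / δ)
  have hfin := finite_int_ball f R'
  have hev1 : ∀ᶠ ε : ℝ in 𝓝[>] 0, ∀ s ∈ {x : E n | IsIntPt (x + f) ∧ ‖x‖ ≤ R'},
      1 < inner ℝ d s → 1 < (1 - ε) * inner ℝ d s + ε * inner ℝ dj s := by
    rw [eventually_all_finite hfin]
    intro s _
    by_cases hs : 1 < inner ℝ d s
    · have hc : Tendsto (fun ε : ℝ => (1 - ε) * inner ℝ d s + ε * inner ℝ dj s) (𝓝[>] 0)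
          (𝓝 ((1 - 0) * inner ℝ d s + 0 * inner ℝ dj s)) := by
        refine Tendsto.mono_left ?_ nhdsWithin_le_nhds
        exact Continuous.tendsto (by fun_prop) 0
      simp only [sub_zero, one_mul, zero_mul, add_zero] at hc
      filter_upwards [hc.eventually_const_lt hs] with ε hε _ using hε
    · exact Eventually.of_forall fun ε h => absurd h hs
  have hev2 : ∀ᶠ ε : ℝ in 𝓝[>] 0, δ / 2 < (1 - ε) * δ - ε * ‖dj‖ := by
    have hc : Tendsto (fun ε : ℝ => (1 - ε) * δ - ε * ‖dj‖) (𝓝[>] 0)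
        (𝓝 ((1 - 0) * δ - 0 * ‖dj‖)) := by
      refine Tendsto.mono_left ?_ nhdsWithin_le_nhds
      exact Continuous.tendsto (by fun_prop) 0
    simp only [sub_zero, one_mul, zero_mul] at hc
    exact hc.eventually_const_lt (by linarith)
  have hev3 : ∀ᶠ ε : ℝ in 𝓝[>] 0, ε ∈ Set.Ioo (0 : ℝ) 1 := Ioo_mem_nhdsGT one_pos
  obtain ⟨ε, hε1, hε2, hε0, hε3⟩ := (hev1.and (hev2.and hev3)).exists
  let d' : E n := (1 - ε) • d + ε • dj
  have hd' : ∀ x, inner ℝ d' x = (1 - ε) * inner ℝ d x + ε * inner ℝ dj x := by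
    intro x
    simp only [d', inner_add_left, real_inner_smul_left]
  have hcov : CovF (TT f A b) q (insert d' (F.erase d)) := by
    constructor
    · intro e he x
      rcases Finset.mem_insert.1 he with rfl | he
      · rw [hd']
        have h1 := mul_le_mul_of_nonneg_left (hF.1 d hd x) (show 0 ≤ 1 - ε by linarith)
        have h2 := mul_le_mul_of_nonneg_left (hF.1 dj hdj x) hε0.le
        linarith
      · exact hF.1 e (Finset.mem_of_mem_erase he) x
    · intro s hs
      by_cases hex : ∃ e ∈ F, e ≠ d ∧ 1 ≤ inner ℝ e s
      · obtain ⟨e, h1, h2, h3⟩ := hex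
        exact ⟨e, Finset.mem_insert_of_mem (Finset.mem_erase.2 ⟨h2, h1⟩), h3⟩
      · push Not at hex
        obtain ⟨s0, hs0, hL⟩ := exists_T0 (Lin q h.sub) hs
        have hinv : ∀ y ∈ F, inner ℝ y s0 = inner ℝ y s := by
          intro y hy
          have := Lin_inner hq hL (hF.1 y hy)
          rw [inner_sub_right] at this
          linarith
        obtain ⟨h1, h2⟩ := hTd s0 hs0.1 (fun e he hne => by rw [hinv e he]; exact hex e he hne)
        refine ⟨d', Finset.mem_insert_self _ _, ?_⟩
        rw [hd', ← hinv d hd, ← hinv dj hdj]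
        by_cases hle : ‖s0‖ ≤ R'
        · exact (hε1 s0 ⟨hs0.1.1, hle⟩ h2).le
        · push Not at hle
          have hb1 : R ≤ ‖s0‖ := (le_max_left _ _).trans hle.le
          have hb3 : 2 / δ ≤ ‖s0‖ := (le_max_right _ _).trans hle.le
          have hH := hR s0 hs0 hb1
          rw [← h1] at hH
          have hcs : -(‖dj‖ * ‖s0‖) ≤ inner ℝ dj s0 :=
            (abs_le.1 (abs_real_inner_le_norm dj s0)).1
          have k1 := mul_le_mul_of_nonneg_left hH (show 0 ≤ 1 - ε by linarith)
          have k2 := mul_le_mul_of_nonneg_left hcs hε0.le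
          have k3 := mul_le_mul_of_nonneg_right hε2.le (norm_nonneg s0)
          rw [div_le_iff₀ hδ] at hb3
          nlinarith
  obtain ⟨e, he, hee⟩ := hcov.attain h hT s1
  obtain ⟨g1, g2⟩ := hTd s1 hs1 hs1lt
  rcases Finset.mem_insert.1 he with rfl | he
  · rw [hd', ← g1] at hee
    have := hs1lt dj hdj hdjne
    nlinarith
  · have := hs1lt e (Finset.mem_of_mem_erase he) (Finset.ne_of_mem_erase he)
    linarith

end aux

/-- Every valid function is dominated by ψ_B for some maximal S-free convex
set B with f in its interior. -/
theorem stmt_17 {n : ℕ} (S : Set (E n)) (hS : IsIntPtsOfRatPolyhedron S)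
    (hdim : FullDimSet S) (f : E n) (hf : f ∈ convexHull ℝ S) (hfi : ¬ IsIntPt f)
    (ψ : E n → ℝ) (hv : ValidFn S f ψ) :
    ∃ (k : ℕ) (a : Fin (k + 1) → E n) (B : Set (E n)),
      MaxSFree S B ∧ f ∈ interior B ∧
      B = {x : E n | ∀ i, dot (a i) (x - f) ≤ 1} ∧
      ∀ r : E n,
        (Finset.univ.sup' Finset.univ_nonempty fun i => dot (a i) r) ≤ ψ r := by
  classical
  obtain ⟨m, A, b, hA, -, hSeq⟩ := hS
  have hmemS : ∀ x, x ∈ S ↔ x - f ∈ TT f A (fun i => b i - inner ℝ (A i) f) := by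
    intro x
    rw [hSeq]
    constructor
    · rintro ⟨h1, h2⟩
      refine ⟨by simpa using h1, fun i => ?_⟩
      have := h2 i
      rw [dot_eq_inner] at this
      rw [inner_sub_right]
      linarith
    · rintro ⟨h1, h2⟩
      refine ⟨by simpa using h1, fun i => ?_⟩
      have := h2 i
      rw [inner_sub_right] at this
      rw [dot_eq_inner]
      linarith
  set T := TT f A (fun i => b i - inner ℝ (A i) f) with hTdef
  have hSne : S.Nonempty := convexHull_nonempty_iff.1 ⟨f, hf⟩
  obtain ⟨p, hp1, hp2, hp3⟩ := exists_sub_of_valid S hSne f ψ hv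
  have hpT : ∀ x ∈ T, 1 ≤ p x := by
    intro x hx
    have := hp3 (x + f) ((hmemS _).2 (by simpa using hx))
    simpa using this
  obtain ⟨q, hq, hqp⟩ := exists_minV T p hp1 hpT
  have hsub := hq.sub
  have hT : T.Nonempty := by
    obtain ⟨s, hs⟩ := hSne
    exact ⟨_, (hmemS s).1 hs⟩
  have h0 : (0 : E n) ∈ convexHull ℝ T := by
    have hconv : Convex ℝ {x : E n | x - f ∈ convexHull ℝ T} := by
      intro x hx y hy a c ha hc hac
      show a • x + c • y - f ∈ convexHull ℝ T
      have e : a • x + c • y - f = a • (x - f) + c • (y - f) := by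
        have : f = (a + c) • f := by rw [hac, one_smul]
        rw [smul_sub, smul_sub, this, hac, one_smul]
        nth_rewrite 1 [this]
        module
      rw [e]
      exact convex_convexHull ℝ T hx hy ha hc hac
    have hss : S ⊆ {x : E n | x - f ∈ convexHull ℝ T} := fun s hs =>
      subset_convexHull ℝ T ((hmemS s).1 hs)
    have hff : f - f ∈ convexHull ℝ T := convexHull_min hss hconv hf
    rwa [sub_self] at hff
  obtain ⟨F, hF, hFmin⟩ : ∃ F, CovF T q F ∧ ∀ F', CovF T q F' → F.card ≤ F'.card := by
    have hex : ∃ k, ∃ F, CovF T q F ∧ F.card = k := by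
      obtain ⟨F, hF⟩ := exists_CovF hA hq hT
      exact ⟨_, F, hF, rfl⟩
    obtain ⟨F, hF, hk⟩ := Nat.find_spec hex
    exact ⟨F, hF, fun F' hF' => hk ▸ Nat.find_min' hex ⟨F', hF', rfl⟩⟩
  have hFne : F.Nonempty := by
    obtain ⟨d, hd, -⟩ := hF.attain hq hT 0
    exact ⟨d, hd⟩
  obtain ⟨k, hk⟩ : ∃ k, F.card = k + 1 := Nat.exists_eq_succ_of_ne_zero hFne.card_pos.ne'
  let e := (F.equivFinOfCardEq hk).symm
  let a : Fin (k + 1) → E n := fun i => (e i : E n)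
  have haF : ∀ i, a i ∈ F := fun i => (e i).2
  have hasurj : ∀ d ∈ F, ∃ i, a i = d := by
    intro d hd
    refine ⟨e.symm ⟨d, hd⟩, ?_⟩
    simp [a]
  let B : Set (E n) := {x : E n | ∀ i, dot (a i) (x - f) ≤ 1}
  have hBmem : ∀ x, x ∈ B ↔ ∀ d ∈ F, inner ℝ d (x - f) ≤ 1 := by
    intro x
    constructor
    · intro hx d hd
      obtain ⟨i, rfl⟩ := hasurj d hd
      have := hx i
      rwa [dot_eq_inner] at this
    · intro hx i
      rw [dot_eq_inner]
      exact hx _ (haF i)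
  have hBq : ∀ x, x ∈ B ↔ q (x - f) ≤ 1 := by
    intro x
    rw [hBmem]
    constructor
    · intro hx
      obtain ⟨d, hd, he⟩ := hF.attain hq hT (x - f)
      rw [← he]
      exact hx d hd
    · intro hx d hd
      exact (hF.1 d hd _).trans hx
  have hinn1 : ∀ x, q (x - f) < 1 → x ∈ interior B := by
    intro x hx
    refine mem_interior.2 ⟨{x | q (x - f) < 1}, fun y hy => (hBq y).2 (le_of_lt hy), ?_, hx⟩
    exact isOpen_lt (hsub.continuous.comp (by fun_prop)) continuous_const
  have hinn2 : ∀ x ∈ interior B, q (x - f) < 1 := by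
    intro x hx
    by_contra hge
    push Not at hge
    have hc : Filter.Tendsto (fun ε : ℝ => x + ε • (x - f)) (nhdsWithin 0 (Set.Ioi 0)) (nhds (x + (0 : ℝ) • (x - f))) := by
      refine Filter.Tendsto.mono_left ?_ nhdsWithin_le_nhds
      exact Continuous.tendsto (by fun_prop) 0
    rw [zero_smul, add_zero] at hc
    have hev := hc.eventually (isOpen_interior.mem_nhds hx)
    obtain ⟨ε, hε, hpos⟩ := (hev.and self_mem_nhdsWithin).exists
    have hpos' : 0 < ε := hpos
    have h1 := (hBq _).1 (interior_subset hε)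
    have e1 : x + ε • (x - f) - f = (1 + ε) • (x - f) := by module
    rw [e1, hsub.1 _ (by linarith)] at h1
    nlinarith
  refine ⟨k, a, B, ⟨?_, ?_, ?_⟩, ?_, rfl, ?_⟩
  · intro x hx y hy s t hs ht hst
    rw [hBq] at hx hy ⊢
    have e1 : s • x + t • y - f = s • (x - f) + t • (y - f) := by
      have : s • f + t • f = f := by rw [← add_smul, hst, one_smul]
      nth_rewrite 1 [← this]
      module
    rw [e1]
    refine (hsub.2 _ _).trans ?_
    rw [hsub.1 _ hs, hsub.1 _ ht]
    nlinarith
  · intro x hx hxS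
    have h1 := hinn2 x hx
    have h2 := hq.cov _ ((hmemS x).1 hxS)
    linarith
  · intro C hC hCS hBC
    refine Set.Subset.antisymm hBC fun c hc => ?_
    rw [hBmem]
    by_contra hno
    push Not at hno
    obtain ⟨d, hd, hdc⟩ := hno
    obtain ⟨s, hs, hs1, hs2⟩ := lemma5 hA hq hT h0 hF hFmin hd
    have hsS : s + f ∈ S := (hmemS _).2 (by simpa using hs)
    have hev : ∀ d' ∈ F, ∀ᶠ ε : ℝ in nhdsWithin 0 (Set.Ioi 0),
        inner ℝ d' s + ε * (inner ℝ d' s - inner ℝ d' (c - f)) < 1 := by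
      intro d' hd'
      by_cases hne : d' = d
      · subst hne
        filter_upwards [self_mem_nhdsWithin] with ε hε
        have hε' : 0 < ε := hε
        rw [hs1]
        nlinarith
      · have hc : Filter.Tendsto (fun ε : ℝ => inner ℝ d' s + ε * (inner ℝ d' s - inner ℝ d' (c - f)))
            (nhdsWithin 0 (Set.Ioi 0))
            (nhds (inner ℝ d' s + 0 * (inner ℝ d' s - inner ℝ d' (c - f)))) := by
          refine Filter.Tendsto.mono_left ?_ nhdsWithin_le_nhds
          exact Continuous.tendsto (by fun_prop) 0
        rw [zero_mul, add_zero] at hc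
        exact hc.eventually_lt_const (hs2 d' hd' hne)
    have hev' := (Filter.eventually_all_finset F).2 hev
    obtain ⟨ε, hε, hpos⟩ := (hev'.and self_mem_nhdsWithin).exists
    have hpos' : 0 < ε := hpos
    have hy : s + f + ε • (s + f - c) ∈ interior B := by
      apply hinn1
      obtain ⟨d', hd', he⟩ := hF.attain hq hT (s + f + ε • (s + f - c) - f)
      rw [← he]
      have e1 : s + f + ε • (s + f - c) - f = s + ε • (s - (c - f)) := by module
      rw [e1, inner_add_right, inner_smul_right, inner_sub_right]
      exact hε d' hd'
    have hyC := interior_mono hBC hy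
    have hx := hC.combo_interior_self_mem_interior hyC hc
      (show 0 < 1 / (1 + ε) by positivity) (show 0 ≤ ε / (1 + ε) by positivity) (by field_simp)
    have e2 : (1 / (1 + ε)) • (s + f + ε • (s + f - c)) + (ε / (1 + ε)) • c = s + f := by
      have h1 : s + f + ε • (s + f - c) = (1 + ε) • (s + f) - ε • c := by module
      have h2 : (1 + ε) ≠ 0 := by positivity
      rw [h1, smul_sub, smul_smul, smul_smul, one_div, inv_mul_cancel₀ h2, one_smul, div_eq_inv_mul]
      simp
    rw [e2] at hx
    exact hCS _ hx hsS
  · apply hinn1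
    rw [sub_self, hsub.map_zero]
    exact one_pos
  · intro r
    refine Finset.sup'_le _ _ fun i _ => ?_
    rw [dot_eq_inner]
    exact ((hF.1 _ (haF i) r).trans (hqp r)).trans (hp2 r)
end
end

section
/- Let ψ : ℝⁿ → ℝ be a minimal valid function and let B_ψ = {x ∈ ℝⁿ : ψ(x − f) ≤ 1}. Then ψ(r) ≥ 0 for all r ∈ ℝⁿ if and only if the recession cone rec(B_ψ) is not full-dimensional. -/
open scoped BigOperators Pointwise

noncomputable section

def IsMinValid {n : ℕ} (S : Set (E n)) (f : E n) (ψ : E n → ℝ) : Prop :=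
  ValidFn S f ψ ∧ ∀ ψ' : E n → ℝ, ValidFn S f ψ' → (∀ r, ψ' r ≤ ψ r) → ψ' = ψ

lemma minValid_comb {n : ℕ} {S : Set (E n)} {f : E n} {ψ : E n → ℝ} (h : IsMinValid S f ψ)
    (r₁ r₂ : E n) (a b : ℝ) (ha : 0 ≤ a) (hb : 0 ≤ b) :
    ψ (a • r₁ + b • r₂) ≤ a * ψ r₁ + b * ψ r₂ := by
  classical
  by_contra hlt
  push Not at hlt
  set r := a • r₁ + b • r₂ with hr
  set v := a * ψ r₁ + b * ψ r₂ with hvdef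
  have key := h.2 (Function.update ψ r v) ?_ ?_
  · have := congrFun key r
    simp at this
    linarith
  · intro s hs hmem
    have h1 := h.1 (s.erase r + Finsupp.single r₁ (s r * a) + Finsupp.single r₂ (s r * b)) ?_ ?_
    · rw [Finsupp.sum_add_index' (by simp) (by intros; ring),
        Finsupp.sum_add_index' (by simp) (by intros; ring),
        Finsupp.sum_single_index (by simp), Finsupp.sum_single_index (by simp)] at h1
      rw [← Finsupp.add_sum_erase' s r _ (by simp)]
      have : ((s.erase r).sum fun x c => Function.update ψ r v x * c)
          = (s.erase r).sum fun x c => ψ x * c := by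
        apply Finsupp.sum_congr
        intro x hx
        rw [Function.update_of_ne]
        rintro rfl
        simp at hx
      rw [this]
      simp only [Function.update_self]
      rw [hvdef]
      linarith
    · intro x
      have h0 : 0 ≤ (s.erase r) x := by
        rw [Finsupp.erase_apply]; split_ifs
        · exact le_rfl
        · exact hs x
      have h1 : 0 ≤ Finsupp.single r₁ (s r * a) x := by
        rw [Finsupp.single_apply]; split_ifs
        · exact mul_nonneg (hs r) ha
        · exact le_rfl
      have h2 : 0 ≤ Finsupp.single r₂ (s r * b) x := by
        rw [Finsupp.single_apply]; split_ifs
        · exact mul_nonneg (hs r) hb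
        · exact le_rfl
      simp only [Finsupp.add_apply]
      linarith
    · rw [Finsupp.sum_add_index' (by simp) (by intros; rw [add_smul]),
        Finsupp.sum_add_index' (by simp) (by intros; rw [add_smul]),
        Finsupp.sum_single_index (by simp), Finsupp.sum_single_index (by simp)]
      rw [← Finsupp.add_sum_erase' s r _ (by simp)] at hmem
      convert hmem using 2
      conv_rhs => rw [hr]
      rw [← hr]
      module
  · intro x
    by_cases hx : x = r
    · subst hx; simp; exact hlt.le
    · rw [Function.update_of_ne hx]

lemma minValid_sublinear {n : ℕ} {S : Set (E n)} {f : E n} {ψ : E n → ℝ}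
    (h : IsMinValid S f ψ) (hne : S.Nonempty) : Sublinear ψ := by
  have hhom : ∀ t : ℝ, 0 ≤ t → ∀ r, ψ (t • r) ≤ t * ψ r := by
    intro t ht r
    have := minValid_comb h r 0 t 0 ht le_rfl
    simpa using this
  have h0 : 0 ≤ ψ 0 := by
    by_contra hlt
    push Not at hlt
    obtain ⟨p, hp⟩ := hne
    have hall : ∀ M : ℝ, 0 ≤ M → 1 ≤ ψ (p - f) + ψ 0 * M := by
      intro M hM
      classical
      have := h.1 (Finsupp.single (p - f) 1 + Finsupp.single 0 M) ?_ ?_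
      · rw [Finsupp.sum_add_index' (by simp) (by intros; ring),
          Finsupp.sum_single_index (by simp), Finsupp.sum_single_index (by simp)] at this
        simpa using this
      · intro x
        simp only [Finsupp.add_apply, Finsupp.single_apply]
        split_ifs <;> linarith
      · rw [Finsupp.sum_add_index' (by simp) (by intros; rw [add_smul]),
          Finsupp.sum_single_index (by simp), Finsupp.sum_single_index (by simp)]
        simpa using hp
    have := hall (|ψ (p - f)| / (-ψ 0)) (div_nonneg (abs_nonneg _) (by linarith))
    have h2 : ψ 0 * (|ψ (p - f)| / (-ψ 0)) = -|ψ (p - f)| := by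
      have : ψ 0 ≠ 0 := hlt.ne
      field_simp
    rw [h2] at this
    linarith [le_abs_self (ψ (p - f))]
  refine ⟨?_, ?_⟩
  · intro t ht r
    rcases ht.eq_or_lt with rfl | ht
    · have := hhom 0 le_rfl r
      simp at this ⊢
      linarith
    · apply le_antisymm (hhom t ht.le r)
      have := hhom t⁻¹ (by positivity) (t • r)
      rw [smul_smul, inv_mul_cancel₀ ht.ne', one_smul] at this
      calc t * ψ r ≤ t * (t⁻¹ * ψ (t • r)) := by gcongr
        _ = ψ (t • r) := by field_simp
  · intro r r'
    have := minValid_comb h r r' 1 1 zero_le_one zero_le_one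
    simpa using this

lemma sublinear_continuous {n : ℕ} {ψ : E n → ℝ} (h : Sublinear ψ) : Continuous ψ := by
  have hc : ConvexOn ℝ Set.univ ψ := by
    refine ⟨convex_univ, ?_⟩
    intro x _ y _ a b ha hb _
    refine (h.2 _ _).trans ?_
    rw [h.1 a ha, h.1 b hb]
    simp
  exact hc.locallyLipschitz.continuous

lemma sublinear_zero {n : ℕ} {ψ : E n → ℝ} (h : Sublinear ψ) : ψ 0 = 0 := by
  have := h.1 0 le_rfl 0
  simpa using this

lemma sublinear_valid {n : ℕ} {S : Set (E n)} {f : E n} {ψ : E n → ℝ} (h : Sublinear ψ)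
    (h1 : ∀ p ∈ S, 1 ≤ ψ (p - f)) : ValidFn S f ψ := by
  intro s hs hmem
  have := h1 _ hmem
  rw [add_sub_cancel_left] at this
  refine this.trans ?_
  unfold Finsupp.sum
  refine (Finset.le_sum_of_subadditive ψ (sublinear_zero h).le h.2 _ _).trans ?_
  apply Finset.sum_le_sum
  intro i _
  rw [h.1 _ (hs i), mul_comm]

lemma valid_ge {n : ℕ} {S : Set (E n)} {f : E n} {ψ : E n → ℝ} (h : ValidFn S f ψ)
    {p : E n} (hp : p ∈ S) : 1 ≤ ψ (p - f) := by
  classical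
  have := h (Finsupp.single (p - f) 1) ?_ ?_
  · rw [Finsupp.sum_single_index (by simp)] at this
    simpa using this
  · intro x
    rw [Finsupp.single_apply]; split_ifs <;> norm_num
  · rw [Finsupp.sum_single_index (by simp)]
    simpa using hp

/-- Tilting lemma. -/
lemma minValid_tilt {n : ℕ} {S : Set (E n)} {f : E n} {ψ : E n → ℝ}
    (h : IsMinValid S f ψ) (hne : S.Nonempty) (d : E n) (η : ℝ) (hη : η ≤ ψ (-d))
    (hval : ∀ p ∈ S, ∀ t : ℝ, 0 ≤ t → 1 ≤ ψ (p - f - t • d) - t * η) :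
    ∀ r, ∀ t : ℝ, 0 ≤ t → ψ r ≤ ψ (r - t • d) - t * η := by
  have hsub := minValid_sublinear h hne
  let g : E n → ℝ := fun r => ⨅ t : Set.Ici (0:ℝ), ψ (r - (t:ℝ) • d) - t * η
  have hbdd : ∀ r, BddBelow (Set.range fun t : Set.Ici (0:ℝ) => ψ (r - (t:ℝ) • d) - t * η) := by
    intro r
    refine ⟨-ψ (-r), ?_⟩
    rintro _ ⟨⟨t, ht⟩, rfl⟩
    simp only
    have ht : 0 ≤ t := ht
    have h1 := hsub.2 (r - t • d) (-r)
    have h2 : r - t • d + -r = t • (-d) := by module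
    rw [h2, hsub.1 t ht] at h1
    nlinarith
  have hgle : ∀ r t, 0 ≤ t → g r ≤ ψ (r - t • d) - t * η := fun r t ht =>
    ciInf_le (hbdd r) (⟨t, ht⟩ : Set.Ici (0:ℝ))
  have hleg : ∀ r c, (∀ t : ℝ, 0 ≤ t → c ≤ ψ (r - t • d) - t * η) → c ≤ g r := fun r c hc =>
    le_ciInf fun t => hc t t.2
  have hgψ : ∀ r, g r ≤ ψ r := fun r => by simpa using hgle r 0 le_rfl
  have hhom : ∀ c : ℝ, 0 < c → ∀ r, c * g r ≤ g (c • r) := by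
    intro c hc r
    apply hleg
    intro t ht
    have h1 := hgle r (t / c) (by positivity)
    have h2 : c • r - t • d = c • (r - (t / c) • d) := by
      rw [smul_sub, smul_smul, mul_div_cancel₀ _ hc.ne']
    rw [h2, hsub.1 c hc.le]
    calc c * g r ≤ c * (ψ (r - (t / c) • d) - t / c * η) := by gcongr
      _ = _ := by field_simp
  have hg0 : g 0 = 0 := by
    apply le_antisymm
    · have := hgψ 0
      rwa [sublinear_zero hsub] at this
    · apply hleg
      intro t ht
      have : (0 : E n) - t • d = t • (-d) := by module
      rw [this, hsub.1 t ht]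
      nlinarith
  have hgs : Sublinear g := by
    constructor
    · intro c hc r
      rcases hc.eq_or_lt with rfl | hc
      · simp [hg0]
      · apply le_antisymm _ (hhom c hc r)
        have := hhom c⁻¹ (by positivity) (c • r)
        rw [smul_smul, inv_mul_cancel₀ hc.ne', one_smul] at this
        calc g (c • r) = c * (c⁻¹ * g (c • r)) := by field_simp
          _ ≤ c * g r := by gcongr
    · intro r r'
      have h1 : g (r + r') - g r' ≤ g r := by
        apply hleg
        intro t ht
        have h2 : g (r + r') - (ψ (r - t • d) - t * η) ≤ g r' := by
          apply hleg
          intro t' ht'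
          have h3 := hgle (r + r') (t + t') (by positivity)
          have h4 := hsub.2 (r - t • d) (r' - t' • d)
          have h5 : r - t • d + (r' - t' • d) = r + r' - (t + t') • d := by module
          rw [h5] at h4
          linarith
        linarith
      linarith
  have hgv : ValidFn S f g := sublinear_valid hgs fun p hp => hleg _ _ (hval p hp)
  have := h.2 g hgv hgψ
  intro r t ht
  rw [← congrFun this r]
  exact hgle r t ht

lemma dirichlet_int {n : ℕ} (d : E n) (ε T : ℝ) (hε : 0 < ε) (hT : 0 < T) :
    ∃ t : ℝ, T ≤ t ∧ ∃ z : E n, IsIntPt z ∧ ‖z - t • d‖ < ε := by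
  let x : ℕ → E n := fun k => WithLp.toLp 2 fun i => Int.fract ((k:ℝ) * T * d i)
  have hb : ∀ k, x k ∈ Metric.closedBall (0 : E n) (∑ i : Fin n, (1:ℝ)) := by
    intro k
    rw [mem_closedBall_zero_iff]
    have h1 : ‖x k‖ ≤ ∑ i, ‖x k i‖ := by
      rw [EuclideanSpace.norm_eq]
      apply Real.sqrt_le_iff.2
      refine ⟨Finset.sum_nonneg fun i _ => norm_nonneg _, ?_⟩
      exact Finset.sum_sq_le_sq_sum_of_nonneg fun i _ => norm_nonneg _
    refine h1.trans (Finset.sum_le_sum fun i _ => ?_)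
    change ‖Int.fract ((k:ℝ) * T * d i)‖ ≤ 1
    rw [Real.norm_eq_abs, abs_of_nonneg (Int.fract_nonneg _)]
    exact (Int.fract_lt_one _).le
  obtain ⟨a, -, φ, hφ, hlim⟩ := tendsto_subseq_of_bounded Metric.isBounded_closedBall hb
  have hc := hlim.cauchySeq
  obtain ⟨N, hN⟩ := Metric.cauchySeq_iff.1 hc ε hε
  have hd := hN N le_rfl (N + 1) (Nat.le_succ N)
  have hlt : φ N < φ (N + 1) := hφ (Nat.lt_succ_self N)
  refine ⟨((φ (N+1) : ℝ) - φ N) * T, ?_,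
    WithLp.toLp 2 fun i => (((⌊(φ (N+1) : ℝ) * T * d i⌋ - ⌊(φ N : ℝ) * T * d i⌋ : ℤ)) : ℝ), ?_, ?_⟩
  · have : (φ N : ℝ) + 1 ≤ φ (N+1) := by exact_mod_cast hlt
    nlinarith
  · intro i
    exact ⟨_, rfl⟩
  · rw [dist_eq_norm] at hd
    refine lt_of_eq_of_lt (congrArg _ ?_) hd
    ext i
    simp only [x, Function.comp, PiLp.sub_apply, PiLp.smul_apply, smul_eq_mul, Int.fract]
    push_cast
    ring

lemma rat_discrete {n : ℕ} (a : E n) (ha : IsRatVec a) :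
    ∃ η : ℝ, 0 < η ∧ ∀ z : E n, IsIntPt z → |dot a z| < η → dot a z = 0 := by
  choose q hq using ha
  let N : ℕ := ∏ i, (q i).den
  have hN : 0 < N := Finset.prod_pos fun i _ => (q i).den_pos
  have hNr : (0:ℝ) < N := by exact_mod_cast hN
  refine ⟨1 / N, by positivity, ?_⟩
  intro z hz hlt
  choose m hm using hz
  have hint : ∀ i, ∃ k : ℤ, (N:ℝ) * (a i * z i) = k := by
    intro i
    obtain ⟨c, hc⟩ : (q i).den ∣ N := Finset.dvd_prod_of_mem _ (Finset.mem_univ i)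
    refine ⟨c * (q i).num * m i, ?_⟩
    have h1 : ((q i).den : ℝ) * (q i : ℝ) = (q i).num := by
      have := Rat.den_mul_eq_num (q i)
      exact_mod_cast this
    rw [hq, hm, hc]
    push_cast
    rw [← h1]
    ring
  choose k hk using hint
  have hsum : (N:ℝ) * dot a z = ((∑ i, k i : ℤ) : ℝ) := by
    unfold dot
    rw [Finset.mul_sum]
    push_cast
    exact Finset.sum_congr rfl fun i _ => hk i
  have habs : |((∑ i, k i : ℤ) : ℝ)| < 1 := by
    rw [← hsum, abs_mul, abs_of_pos hNr]
    rw [lt_div_iff₀ hNr] at hlt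
    linarith
  have h0 : (∑ i, k i : ℤ) = 0 := by
    apply Int.abs_lt_one_iff.1
    exact_mod_cast habs
  rw [h0] at hsum
  simp at hsum
  rcases hsum with h | h
  · omega
  · exact h

/-- `dot a` as a continuous linear functional. -/
def dotL {n : ℕ} (a : E n) : E n →L[ℝ] ℝ := innerSL ℝ a

lemma dotL_apply {n : ℕ} (a x : E n) : dotL a x = dot a x := by
  unfold dotL dot
  rw [innerSL_apply_apply, PiLp.inner_apply]
  simp [mul_comm]

/-- Moving along a common recession direction keeps the inequality. -/
lemma ray_ge {n m : ℕ} {S : Set (E n)} {f : E n} {ψ : E n → ℝ}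
    (φ : Fin m → E n →L[ℝ] ℝ) (b : Fin m → ℝ)
    (hφ : ∀ i, ∃ η : ℝ, 0 < η ∧ ∀ z : E n, IsIntPt z → |φ i z| < η → φ i z = 0)
    (hS : S = {x | IsIntPt x ∧ ∀ i, φ i x ≤ b i})
    (hv : ValidFn S f ψ) (hs : Sublinear ψ) (d : E n) (hd : ∀ i, φ i d ≤ 0) (hψd : ψ d ≤ 0)
    (p : E n) (hp : p ∈ S) (t₀ : ℝ) : 1 ≤ ψ (p - f + t₀ • d) := by
  by_contra hlt
  push Not at hlt
  have hcont := sublinear_continuous hs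
  have hopen : IsOpen {x | ψ x < 1} := isOpen_lt hcont continuous_const
  obtain ⟨ε, hε, hball⟩ := Metric.isOpen_iff.1 hopen _ hlt
  choose η hη hdisc using hφ
  have ev1 : ∀ᶠ T : ℝ in Filter.atTop, ∀ i, φ i d < 0 → T * φ i d + η i ≤ 0 := by
    rw [Filter.eventually_all]
    intro i
    by_cases hi : φ i d < 0
    · filter_upwards [Filter.eventually_ge_atTop (η i / (-φ i d))] with T hT _
      rw [div_le_iff₀ (by linarith)] at hT
      linarith
    · exact Filter.Eventually.of_forall fun T h => absurd h hi
  obtain ⟨T, hT1, hT2⟩ := (ev1.and (Filter.eventually_ge_atTop (max 1 t₀))).exists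
  have ev2 : ∀ᶠ δ : ℝ in nhdsWithin 0 (Set.Ioi 0), ∀ i, ‖φ i‖ * δ < η i := by
    rw [Filter.eventually_all]
    intro i
    have : Filter.Tendsto (fun δ : ℝ => ‖φ i‖ * δ) (nhdsWithin 0 (Set.Ioi 0)) (nhds (‖φ i‖ * 0)) :=
      (Continuous.tendsto (by fun_prop) _).mono_left nhdsWithin_le_nhds
    rw [mul_zero] at this
    exact this.eventually_lt_const (hη i)
  obtain ⟨δ, hδ1, hδ0⟩ := (ev2.and self_mem_nhdsWithin).exists
  have hδ0 : 0 < δ := hδ0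
  obtain ⟨t, htT, z, hz, hzd⟩ := dirichlet_int d (min δ ε) T (lt_min hδ0 hε)
    (lt_of_lt_of_le zero_lt_one ((le_max_left _ _).trans hT2))
  have hbd : ∀ i, |φ i z - t * φ i d| < η i := by
    intro i
    have h1 : φ i z - t * φ i d = φ i (z - t • d) := by simp
    rw [h1]
    calc |φ i (z - t • d)| ≤ ‖φ i‖ * ‖z - t • d‖ := (φ i).le_opNorm _
      _ ≤ ‖φ i‖ * δ := by gcongr; exact hzd.le.trans (min_le_left _ _)
      _ < η i := hδ1 i
  have hmem : p + z ∈ S := by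
    rw [hS] at hp ⊢
    refine ⟨?_, ?_⟩
    · intro i
      obtain ⟨u, hu⟩ := hp.1 i
      obtain ⟨w, hw⟩ := hz i
      exact ⟨u + w, by simp [hu, hw]⟩
    · intro i
      have h1 := hp.2 i
      rw [map_add]
      suffices φ i z ≤ 0 by linarith
      have h2 := hbd i
      rcases (hd i).lt_or_eq with h | h
      · have h3 := hT1 i h
        have h4 := (abs_lt.1 h2).2
        nlinarith
      · rw [h, mul_zero, sub_zero] at h2
        exact (hdisc i z hz h2).le
  have hge := valid_ge hv hmem
  have htt : t₀ ≤ t := (le_max_right _ _).trans (hT2.trans htT)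
  have h5 : ψ (p - f + t₀ • d + (z - t • d)) < 1 := by
    apply hball
    rw [Metric.mem_ball, dist_eq_norm, add_sub_cancel_left]
    exact hzd.trans_le (min_le_right _ _)
  have h6 : p + z - f = (p - f + t₀ • d + (z - t • d)) + (t - t₀) • d := by module
  have h7 := hs.2 (p - f + t₀ • d + (z - t • d)) ((t - t₀) • d)
  rw [← h6, hs.1 _ (by linarith)] at h7
  nlinarith

lemma core {n m : ℕ} {S : Set (E n)} {f : E n} {ψ : E n → ℝ}
    (φ : Fin m → E n →L[ℝ] ℝ) (b : Fin m → ℝ)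
    (hφ : ∀ i, ∃ η : ℝ, 0 < η ∧ ∀ z : E n, IsIntPt z → |φ i z| < η → φ i z = 0)
    (hS : S = {x | IsIntPt x ∧ ∀ i, φ i x ≤ b i}) (hne : S.Nonempty)
    (h : IsMinValid S f ψ) (hpos : ∀ r, 0 ≤ ψ r) (r₀ : E n) (ε : ℝ) (hε : 0 < ε)
    (hball : ∀ u : E n, ‖u‖ ≤ ε → ψ (r₀ + u) ≤ 0) : False := by
  have hs := minValid_sublinear h hne
  have hcont := sublinear_continuous hs
  have hψ0 := sublinear_zero hs
  let D : Set (E n) := {d | (∀ i, φ i d ≤ 0) ∧ ψ d ≤ 0}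
  have hD : ∀ d ∈ D, ∀ r, ψ r ≤ ψ (r + d) := by
    intro d hd r
    have := minValid_tilt h hne (-d) 0 (hpos _) ?_ r 1 zero_le_one
    · simpa using this
    · intro p hp t _
      have := ray_ge φ b hφ hS h.1 hs d hd.1 hd.2 p hp t
      simpa using this
  have hDsum : ∀ g : Fin m → E n, (∀ i, g i ∈ D) → ∑ i, g i ∈ D := by
    intro g hg
    refine ⟨fun i => ?_, ?_⟩
    · rw [map_sum]
      exact Finset.sum_nonpos fun j _ => (hg j).1 i
    · refine (Finset.le_sum_of_subadditive ψ hψ0.le hs.2 _ _).trans ?_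
      exact Finset.sum_nonpos fun j _ => (hg j).2
  let L : Submodule ℝ (E n) := Submodule.span ℝ D
  have hL : ∀ l ∈ L, ∀ r, ψ (r + l) = ψ r := by
    intro l hl
    induction hl using Submodule.span_induction with
    | mem d hd =>
      intro r
      apply le_antisymm _ (hD d hd r)
      have := hs.2 r d
      have := hd.2
      linarith
    | zero => intro r; simp
    | add x y _ _ hx hy => intro r; rw [← add_assoc, hy, hx]
    | smul c x _ hx =>
      have hp : ∀ c : ℝ, 0 ≤ c → ∀ r, ψ (r + c • x) = ψ r := by
        intro c hc r
        rcases hc.eq_or_lt with rfl | hc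
        · simp
        · have h1 : r + c • x = c • (c⁻¹ • r + x) := by
            rw [smul_add, smul_smul, mul_inv_cancel₀ hc.ne', one_smul]
          rw [h1, hs.1 c hc.le, hx, ← hs.1 c hc.le, smul_smul, mul_inv_cancel₀ hc.ne', one_smul]
      intro r
      rcases le_total 0 c with hc | hc
      · exact hp c hc r
      · rw [← hp (-c) (by linarith) (r + c • x)]
        congr 1
        module
  have hchoice : ∀ i, ∃ e ∈ D, φ i e = 0 → ∀ d ∈ D, φ i d = 0 := by
    intro i
    by_cases hi : ∃ d ∈ D, φ i d ≠ 0
    · obtain ⟨d, hd, hd'⟩ := hi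
      exact ⟨d, hd, fun h => absurd h hd'⟩
    · push Not at hi
      exact ⟨0, ⟨by simp, hψ0.le⟩, fun _ => hi⟩
  choose e heD he using hchoice
  set d₀ := ∑ i, e i with hd₀
  have hd₀D : d₀ ∈ D := hDsum e heD
  have hd₀L : d₀ ∈ L := Submodule.subset_span hd₀D
  have hI : ∀ i, φ i d₀ = 0 → ∀ l ∈ L, φ i l = 0 := by
    intro i hi
    have h1 : φ i (e i) = 0 := by
      rw [hd₀, map_sum] at hi
      exact (Finset.sum_eq_zero_iff_of_nonpos fun j _ => (heD j).1 i).1 hi i (Finset.mem_univ i)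
    have h2 : L ≤ LinearMap.ker (φ i : E n →ₗ[ℝ] ℝ) := by
      apply Submodule.span_le.2
      intro d hd
      exact he i h1 d hd
    intro l hl
    exact h2 hl
  have hδ : ∃ δ : ℝ, 0 < δ ∧ ∀ w ∈ Lᗮ, (∀ i, φ i d₀ = 0 → φ i w ≤ b i - φ i f) → 1 ≤ ψ w →
      δ * ‖w‖ ≤ ψ w := by
    by_contra hcon
    push Not at hcon
    choose w hwL hwφ hw1 hwlt using fun k : ℕ => hcon (1 / ((k:ℝ) + 1)) (by positivity)
    have hwn : ∀ k : ℕ, (k:ℝ) + 1 < ‖w k‖ := by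
      intro k
      have h1 := (hw1 k).trans_lt (hwlt k)
      rw [one_div, inv_mul_eq_div, lt_div_iff₀ (by positivity)] at h1
      linarith
    have hw0 : ∀ k : ℕ, 0 < ‖w k‖ := fun k => lt_trans (by positivity) (hwn k)
    let u : ℕ → E n := fun k => ‖w k‖⁻¹ • w k
    have hu1 : ∀ k, u k ∈ Metric.sphere (0 : E n) 1 := by
      intro k
      rw [mem_sphere_zero_iff_norm, norm_smul, norm_inv, norm_norm, inv_mul_cancel₀ (hw0 k).ne']
    obtain ⟨a, ha, σ, hσ, hlim⟩ := (isCompact_sphere (0 : E n) 1).tendsto_subseq hu1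
    have h1k : Filter.Tendsto (fun k : ℕ => 1 / ((σ k : ℝ) + 1)) Filter.atTop (nhds 0) :=
      tendsto_one_div_add_atTop_nhds_zero_nat.comp hσ.tendsto_atTop
    have haψ : ψ a ≤ 0 := by
      refine le_of_tendsto_of_tendsto' ((hcont.tendsto a).comp hlim) h1k ?_
      intro k
      have h2 := hwlt (σ k)
      simp only [Function.comp, u]
      rw [hs.1 _ (inv_nonneg.2 (hw0 _).le), inv_mul_eq_div, div_le_iff₀ (hw0 _)]
      exact h2.le
    have haφ : ∀ i, φ i d₀ = 0 → φ i a ≤ 0 := by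
      intro i hi
      have h3 := h1k.const_mul |b i - φ i f|
      rw [mul_zero] at h3
      refine le_of_tendsto_of_tendsto' (((φ i).continuous.tendsto a).comp hlim) h3 ?_
      intro k
      have h2 := hwφ (σ k) i hi
      simp only [Function.comp, u, map_smul, smul_eq_mul]
      rw [mul_one_div, inv_mul_eq_div]
      apply div_le_div₀ (abs_nonneg _) (h2.trans (le_abs_self _)) (by positivity) (hwn _).le
    have haL : a ∈ Lᗮ := by
      refine (Submodule.isClosed_orthogonal L).mem_of_tendsto hlim (Filter.Eventually.of_forall ?_)
      intro k
      exact Submodule.smul_mem _ _ (hwL _)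
    have ev : ∀ᶠ t : ℝ in Filter.atTop, ∀ i, φ i (a + t • d₀) ≤ 0 := by
      rw [Filter.eventually_all]
      intro i
      rcases (hd₀D.1 i).lt_or_eq with hi | hi
      · filter_upwards [Filter.eventually_ge_atTop (φ i a / (-φ i d₀))] with t ht
        rw [div_le_iff₀ (by linarith)] at ht
        simp
        linarith
      · refine Filter.Eventually.of_forall fun t => ?_
        simp [hi, haφ i hi]
    obtain ⟨t, ht⟩ := ev.exists
    have hmem : a + t • d₀ ∈ D := by
      refine ⟨ht, ?_⟩
      rw [hL _ (L.smul_mem t hd₀L)]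
      exact haψ
    have haL' : a ∈ L := by
      have := L.sub_mem (Submodule.subset_span hmem) (L.smul_mem t hd₀L)
      simpa using this
    have ha0 : a = 0 := by
      have := (Submodule.mem_orthogonal L a).1 haL a haL'
      simpa using this
    rw [ha0] at ha
    simp at ha
  obtain ⟨δ, hδ0, hδ⟩ := hδ
  have hmain : ∀ p ∈ S, ∀ t : ℝ, 0 ≤ t → ψ (p - f) + t * (ε * δ) ≤ ψ (p - f - t • r₀) := by
    intro p hp t ht
    have hp1 := valid_ge h.1 hp
    set l := L.starProjection (p - f) with hl
    have hlL : l ∈ L := Submodule.starProjection_apply_mem L _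
    obtain ⟨w, hw⟩ : ∃ w, w = p - f - l := ⟨_, rfl⟩
    have hwL : w ∈ Lᗮ := by rw [hw]; exact Submodule.sub_starProjection_mem_orthogonal _
    have hpw : p - f = w + l := by rw [hw]; abel
    have e1 : ψ (p - f) = ψ w := by rw [hpw, hL l hlL]
    have e2 : ψ (p - f - t • r₀) = ψ (w - t • r₀) := by
      rw [hpw, ← hL l hlL (w - t • r₀)]
      congr 1
      abel
    rw [e1] at hp1
    rw [e1, e2]
    have hw2 := hδ w hwL (fun i hi => by
      have h1 := hI i hi l hlL
      rw [hw, map_sub, map_sub, h1, sub_zero]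
      rw [hS] at hp
      linarith [hp.2 i]) hp1
    have hw0 : 0 < ‖w‖ := by
      rw [norm_pos_iff]
      rintro rfl
      rw [hψ0] at hp1
      linarith
    have h3 : ψ (t • (r₀ + (ε / ‖w‖) • w)) ≤ 0 := by
      rw [hs.1 t ht]
      apply mul_nonpos_of_nonneg_of_nonpos ht
      apply hball
      rw [norm_smul, Real.norm_eq_abs, abs_of_pos (by positivity), div_mul_cancel₀ _ hw0.ne']
    have h4 := hs.2 (w - t • r₀) (t • (r₀ + (ε / ‖w‖) • w))
    have h5 : w - t • r₀ + t • (r₀ + (ε / ‖w‖) • w) = (1 + t * (ε / ‖w‖)) • w := by module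
    rw [h5, hs.1 _ (by positivity)] at h4
    have h6 : t * (ε * δ) ≤ t * (ε / ‖w‖) * ψ w := by
      calc t * (ε * δ) = t * (ε / ‖w‖) * (δ * ‖w‖) := by field_simp
        _ ≤ _ := by gcongr
    linarith
  obtain ⟨p, hp⟩ := hne
  have hη : ε * δ ≤ ψ (-r₀) := by
    have h1 := hmain p hp 1 zero_le_one
    have h2 := hs.2 (p - f) (-r₀)
    rw [one_smul, sub_eq_add_neg (p - f)] at h1
    linarith
  have := minValid_tilt h ⟨p, hp⟩ r₀ (ε * δ) hη (fun q hq t ht => by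
    have h1 := hmain q hq t ht
    have h2 := valid_ge h.1 hq
    linarith) r₀ 1 zero_le_one
  rw [one_smul, sub_self, hψ0] at this
  have h1 := hpos r₀
  have h2 : 0 < ε * δ := by positivity
  linarith

/-- For a minimal valid function ψ, ψ is nonnegative if and only if the
recession cone of B_ψ = {x | ψ(x-f) ≤ 1} is not full-dimensional. -/
theorem stmt_19 {n : ℕ} (S : Set (E n)) (hS : IsIntPtsOfRatPolyhedron S)
    (hdim : FullDimSet S) (f : E n) (hf : f ∈ convexHull ℝ S) (hfi : ¬ IsIntPt f)
    (ψ : E n → ℝ) (hv : ValidFn S f ψ)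
    (hmin : ∀ ψ' : E n → ℝ, ValidFn S f ψ' → (∀ r, ψ' r ≤ ψ r) → ψ' = ψ) :
    (∀ r : E n, 0 ≤ ψ r) ↔
      affineSpan ℝ (recCone {x : E n | ψ (x - f) ≤ 1}) ≠ ⊤ := by
  obtain ⟨m, A, b, hA, -, hSeq⟩ := hS
  have hne : S.Nonempty := by
    obtain ⟨p, hp, -⟩ := hdim
    exact ⟨p 0, hp 0⟩
  have h : IsMinValid S f ψ := ⟨hv, hmin⟩
  have hs := minValid_sublinear h hne
  have hcont := sublinear_continuous hs
  have hψ0 := sublinear_zero hs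
  constructor
  · intro hpos htop
    have hsubset : recCone {x : E n | ψ (x - f) ≤ 1} ⊆ {r | ψ r ≤ 0} := by
      intro d hd
      by_contra hlt
      have hlt : 0 < ψ d := not_le.1 hlt
      have h1 := hd f (by simp [hψ0]) (2 / ψ d) (by positivity)
      have h2 : ψ (f + (2 / ψ d) • d - f) ≤ 1 := h1
      rw [add_sub_cancel_left, hs.1 _ (by positivity), div_mul_cancel₀ _ hlt.ne'] at h2
      linarith
    have hconv : Convex ℝ {r | ψ r ≤ 0} := by
      intro x hx y hy a c ha hc _
      have hx : ψ x ≤ 0 := hx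
      have hy : ψ y ≤ 0 := hy
      have h1 := hs.2 (a • x) (c • y)
      rw [hs.1 a ha, hs.1 c hc] at h1
      change ψ (a • x + c • y) ≤ 0
      nlinarith
    have htop' : affineSpan ℝ {r | ψ r ≤ 0} = ⊤ :=
      top_le_iff.1 (htop ▸ affineSpan_mono ℝ hsubset)
    obtain ⟨r₀, hr₀⟩ := hconv.interior_nonempty_iff_affineSpan_eq_top.2 htop'
    obtain ⟨ε, hε, hball⟩ := Metric.isOpen_iff.1 isOpen_interior r₀ hr₀
    refine core (fun i => dotL (A i)) b ?_ ?_ hne h hpos r₀ (ε / 2) (by positivity) ?_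
    · intro i
      simp only [dotL_apply]
      exact rat_discrete (A i) (hA i)
    · simp only [dotL_apply]
      exact hSeq
    · intro u hu
      have : r₀ + u ∈ {r | ψ r ≤ 0} := by
        apply interior_subset
        apply hball
        rw [Metric.mem_ball, dist_eq_norm, add_sub_cancel_left]
        linarith
      exact this
  · intro hnt
    by_contra hcon
    push Not at hcon
    obtain ⟨r, hr⟩ := hcon
    apply hnt
    have hopen : IsOpen {x | ψ x < 0} := isOpen_lt hcont continuous_const
    have h1 := hopen.affineSpan_eq_top ⟨r, hr⟩
    apply top_le_iff.1
    rw [← h1]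
    apply affineSpan_mono
    intro d hd x hx t ht
    have hd : ψ d < 0 := hd
    have hx : ψ (x - f) ≤ 1 := hx
    change ψ (x + t • d - f) ≤ 1
    have h2 := hs.2 (x - f) (t • d)
    rw [hs.1 t ht] at h2
    have h3 : x + t • d - f = x - f + t • d := by abel
    rw [h3]
    nlinarith
end
end
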